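/- arXiv:2001.03873 — 2 statements merged into one kernel-verified Lean document; each statement's English description precedes it below -/
import Mathlib

section
/- Let φ: ℝ^d → ℝ^d satisfy ‖φ‖_∞ ≤ κ and ‖∇φ‖_∞ ≤ κ with κ ≤ 1/2. For any θ ∈ [0,1] there exists C = C(d,θ) > 0 such that for any bounded measurable f: ℝ^d → ℝ and any g ∈ C¹(ℝ^d) with g, ∇g ∈ L¹(ℝ^d), |∫_{ℝ^d} (f(x+φ(x)) − f(x+φ(0))) g(x) dx| ≤ C κ^θ ‖f‖_∞ ( μ₀(|g|) + μ_θ(|∇g|)^θ μ_θ(|g|)^{1−θ} ), where μ_θ(h) := ∫_{ℝ^d} h(x) (|x| ∧ 1)^θ dx. -/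
open MeasureTheory Set

theorem aux_vol_smul (d : ℕ) : ∃ c : NNReal, (volume : Measure (EuclideanSpace ℝ (Fin d))) =
    c • Measure.hausdorffMeasure (d : ℝ) := by
  have h := MeasureTheory.isAddHaarMeasure_hausdorffMeasure (E := EuclideanSpace ℝ (Fin d))
  simp only [finrank_euclideanSpace, Fintype.card_fin] at h
  exact ⟨_, Measure.isAddLeftInvariant_eq_smul _ _⟩

theorem aux_image {d : ℕ} {K : NNReal} {T : EuclideanSpace ℝ (Fin d) → EuclideanSpace ℝ (Fin d)}
    (hT : LipschitzWith K T) (A : Set (EuclideanSpace ℝ (Fin d))) :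
    volume (T '' A) ≤ (K : ENNReal) ^ d * volume A := by
  obtain ⟨c, hc⟩ := aux_vol_smul d
  have := hT.hausdorffMeasure_image_le (d := (d : ℝ)) (Nat.cast_nonneg d) A
  rw [hc, Measure.smul_apply, Measure.smul_apply, mul_smul_comm]
  rw [ENNReal.rpow_natCast] at this
  gcongr

theorem aux_preimage {d : ℕ} {K : NNReal} {T : EuclideanSpace ℝ (Fin d) → EuclideanSpace ℝ (Fin d)}
    (hT : AntilipschitzWith K T) (A : Set (EuclideanSpace ℝ (Fin d))) :
    volume (T ⁻¹' A) ≤ (K : ENNReal) ^ d * volume A := by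
  obtain ⟨c, hc⟩ := aux_vol_smul d
  have := hT.hausdorffMeasure_preimage_le (d := (d : ℝ)) (Nat.cast_nonneg d) A
  rw [hc, Measure.smul_apply, Measure.smul_apply, mul_smul_comm]
  rw [ENNReal.rpow_natCast] at this
  gcongr

theorem aux_lip {d : ℕ} {κ : ℝ} (h0 : 0 ≤ κ)
    {ψ : EuclideanSpace ℝ (Fin d) → EuclideanSpace ℝ (Fin d)}
    (hψ : ∀ x y, ‖ψ x - ψ y‖ ≤ κ * ‖x - y‖) :
    LipschitzWith (Real.toNNReal (1 + κ)) (fun x => x + ψ x) := by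
  refine LipschitzWith.of_dist_le_mul fun x y => ?_
  rw [Real.coe_toNNReal _ (by linarith), dist_eq_norm, dist_eq_norm]
  calc ‖x + ψ x - (y + ψ y)‖ = ‖(x - y) + (ψ x - ψ y)‖ := by congr 1; abel
    _ ≤ ‖x - y‖ + ‖ψ x - ψ y‖ := norm_add_le _ _
    _ ≤ _ := by linarith [hψ x y]

theorem aux_anti {d : ℕ} {κ : ℝ} (h1 : κ ≤ 1 / 2)
    {ψ : EuclideanSpace ℝ (Fin d) → EuclideanSpace ℝ (Fin d)}
    (hψ : ∀ x y, ‖ψ x - ψ y‖ ≤ κ * ‖x - y‖) :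
    AntilipschitzWith (Real.toNNReal (1 - κ)⁻¹) (fun x => x + ψ x) := by
  refine AntilipschitzWith.of_le_mul_dist fun x y => ?_
  have hk : 0 < 1 - κ := by linarith
  rw [Real.coe_toNNReal _ (by positivity), dist_eq_norm, dist_eq_norm]
  rw [← div_eq_inv_mul, le_div_iff₀ hk]
  have : ‖x - y‖ ≤ ‖x + ψ x - (y + ψ y)‖ + ‖ψ x - ψ y‖ := by
    calc ‖x - y‖ = ‖(x + ψ x - (y + ψ y)) - (ψ x - ψ y)‖ := by congr 1; abel
      _ ≤ _ := norm_sub_le _ _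
  linarith [hψ x y]

theorem aux_homeo {d : ℕ} {κ : ℝ} (h0 : 0 ≤ κ) (h1 : κ ≤ 1 / 2)
    {ψ : EuclideanSpace ℝ (Fin d) → EuclideanSpace ℝ (Fin d)}
    (hψ : ∀ x y, ‖ψ x - ψ y‖ ≤ κ * ‖x - y‖) :
    ∃ e : EuclideanSpace ℝ (Fin d) ≃ₜ EuclideanSpace ℝ (Fin d), ∀ x, e x = x + ψ x := by
  have hA : ApproximatesLinearOn (fun x => x + ψ x)
      ((ContinuousLinearEquiv.refl ℝ (EuclideanSpace ℝ (Fin d)) :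
        EuclideanSpace ℝ (Fin d) ≃L[ℝ] EuclideanSpace ℝ (Fin d)) :
        EuclideanSpace ℝ (Fin d) →L[ℝ] EuclideanSpace ℝ (Fin d)) univ (Real.toNNReal κ) := by
    intro x _ y _
    rw [Real.coe_toNNReal _ h0]
    refine le_trans (le_of_eq ?_) (hψ x y)
    congr 1
    simp
    abel
  have hc : Subsingleton (EuclideanSpace ℝ (Fin d)) ∨ Real.toNNReal κ <
      ‖((ContinuousLinearEquiv.refl ℝ (EuclideanSpace ℝ (Fin d))).symm :
        EuclideanSpace ℝ (Fin d) →L[ℝ] EuclideanSpace ℝ (Fin d))‖₊⁻¹ := by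
    rcases subsingleton_or_nontrivial (EuclideanSpace ℝ (Fin d)) with h | h
    · exact Or.inl h
    · right
      have : ‖((ContinuousLinearEquiv.refl ℝ (EuclideanSpace ℝ (Fin d))).symm :
        EuclideanSpace ℝ (Fin d) →L[ℝ] EuclideanSpace ℝ (Fin d))‖₊ = 1 := by
        ext
        exact ContinuousLinearMap.norm_id
      rw [this, inv_one, Real.toNNReal_lt_one]
      linarith
  exact ⟨hA.toHomeomorph _ hc, fun x => rfl⟩

theorem aux_nu_le {d : ℕ} {κ : ℝ} (h0 : 0 ≤ κ)
    {ψ : EuclideanSpace ℝ (Fin d) → EuclideanSpace ℝ (Fin d)}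
    (hψ : ∀ x y, ‖ψ x - ψ y‖ ≤ κ * ‖x - y‖)
    (e : EuclideanSpace ℝ (Fin d) ≃ₜ EuclideanSpace ℝ (Fin d)) (he : ∀ x, e x = x + ψ x) :
    Measure.map e.symm.toMeasurableEquiv volume ≤
      ENNReal.ofReal ((1 + κ) ^ d) • (volume : Measure (EuclideanSpace ℝ (Fin d))) := by
  refine Measure.le_iff.2 fun A hA => ?_
  rw [MeasurableEquiv.map_apply, Measure.smul_apply, smul_eq_mul,
    ENNReal.ofReal_pow (by linarith)]
  have := aux_image (aux_lip h0 hψ) A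
  have h2 : (e.symm.toMeasurableEquiv ⁻¹' A) = (fun x => x + ψ x) '' A := by
    rw [← funext he]
    exact (e.toEquiv.image_eq_preimage_symm A).symm
  rw [h2]
  exact this

theorem aux_le_nu {d : ℕ} {κ : ℝ} (h1 : κ ≤ 1 / 2)
    {ψ : EuclideanSpace ℝ (Fin d) → EuclideanSpace ℝ (Fin d)}
    (hψ : ∀ x y, ‖ψ x - ψ y‖ ≤ κ * ‖x - y‖)
    (e : EuclideanSpace ℝ (Fin d) ≃ₜ EuclideanSpace ℝ (Fin d)) (he : ∀ x, e x = x + ψ x) :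
    ENNReal.ofReal ((1 - κ) ^ d) • (volume : Measure (EuclideanSpace ℝ (Fin d))) ≤
      Measure.map e.symm.toMeasurableEquiv volume := by
  have hk : 0 < 1 - κ := by linarith
  refine Measure.le_iff.2 fun A hA => ?_
  rw [MeasurableEquiv.map_apply, Measure.smul_apply, smul_eq_mul]
  have := aux_preimage (aux_anti h1 hψ) (e.symm.toMeasurableEquiv ⁻¹' A)
  have h2 : (fun x => x + ψ x) ⁻¹' (e.symm.toMeasurableEquiv ⁻¹' A) = A := by
    rw [← funext he]
    ext x
    simp
  rw [h2] at this
  have h3 : ((Real.toNNReal (1 - κ)⁻¹ : NNReal) : ENNReal) ^ d = ENNReal.ofReal (((1 - κ)^d)⁻¹) := by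
    rw [← inv_pow, ENNReal.ofReal_pow (by positivity)]; rfl
  rw [h3] at this
  calc _ ≤ ENNReal.ofReal ((1 - κ) ^ d) * (ENNReal.ofReal (((1 - κ)^d)⁻¹) *
      volume (e.symm.toMeasurableEquiv ⁻¹' A)) := by gcongr
    _ = _ := by
      rw [← mul_assoc, ← ENNReal.ofReal_mul (by positivity), mul_inv_cancel₀ (by positivity)]
      simp

theorem aux_lint {d : ℕ} {κ : ℝ} (h0 : 0 ≤ κ) (h1 : κ ≤ 1 / 2)
    {ψ : EuclideanSpace ℝ (Fin d) → EuclideanSpace ℝ (Fin d)}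
    (hψ : ∀ x y, ‖ψ x - ψ y‖ ≤ κ * ‖x - y‖) {F : EuclideanSpace ℝ (Fin d) → ENNReal}
    (hF : Measurable F) :
    ∫⁻ x, F (x + ψ x) ≤ 2 ^ d * ∫⁻ x, F x := by
  have hk : 0 < 1 - κ := by linarith
  have hm : Measurable (fun x => x + ψ x) := (aux_lip h0 hψ).continuous.measurable
  rw [← lintegral_map hF hm, ← lintegral_const_mul _ hF, ← lintegral_const_mul _ hF |>.symm,
    ← smul_eq_mul, ← lintegral_smul_measure]
  refine lintegral_mono' (Measure.le_iff.2 fun A hA => ?_) le_rfl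
  rw [Measure.map_apply hm hA, Measure.smul_apply, smul_eq_mul]
  refine (aux_preimage (aux_anti h1 hψ) A).trans ?_
  gcongr
  have : (1 - κ)⁻¹ ≤ 2 := by
    rw [inv_le_comm₀ hk (by norm_num)]; linarith
  calc ENNReal.ofReal (1 - κ)⁻¹ ≤ ENNReal.ofReal 2 := ENNReal.ofReal_le_ofReal this
    _ = 2 := by simp

theorem aux_ftc {d : ℕ} {g : EuclideanSpace ℝ (Fin d) → ℝ} (hg : ContDiff ℝ 1 g)
    (x v : EuclideanSpace ℝ (Fin d)) :
    ‖g (x + v) - g x‖ₑ ≤ ‖v‖ₑ * ∫⁻ s in Icc (0 : ℝ) 1, ‖fderiv ℝ g (x + s • v)‖ₑ := by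
  have hc : ContDiff ℝ 1 (fun s : ℝ => g (x + s • v)) := by fun_prop
  have h := enorm_sub_le_lintegral_deriv_of_contDiffOn_Icc (a := (0:ℝ)) (b := 1)
    hc.contDiffOn zero_le_one
  simp only [one_smul, zero_smul, add_zero] at h
  refine h.trans ?_
  rw [← lintegral_const_mul' _ _ enorm_ne_top]
  refine lintegral_mono fun s => ?_
  have hd : HasDerivAt (fun s : ℝ => g (x + s • v)) (fderiv ℝ g (x + s • v) v) s := by
    have h1 : HasDerivAt (fun s : ℝ => x + s • v) v s := by
      simpa using ((hasDerivAt_id s).smul_const v).const_add x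
    exact ((hg.differentiable one_ne_zero) _).hasFDerivAt.comp_hasDerivAt s h1
  rw [hd.deriv, mul_comm]
  exact ContinuousLinearMap.le_opENorm _ _

theorem aux_main {d : ℕ} {κ θ : ℝ} (hθ0 : 0 ≤ θ) (hθ1 : θ ≤ 1) (h0 : 0 ≤ κ) (h1 : κ ≤ 1 / 2)
    {ψ : EuclideanSpace ℝ (Fin d) → EuclideanSpace ℝ (Fin d)}
    (hψ : ∀ x y, ‖ψ x - ψ y‖ ≤ κ * ‖x - y‖) (hψ0 : ψ 0 = 0) (hψb : ∀ x, ‖ψ x‖ ≤ 2 * κ)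
    {g : EuclideanSpace ℝ (Fin d) → ℝ} (hg : ContDiff ℝ 1 g) :
    ∫⁻ x, ‖g (x + ψ x) - g x‖ₑ ≤ ENNReal.ofReal (2 * κ) ^ θ *
      ((2 * 2 ^ d * ∫⁻ x, ‖fderiv ℝ g x‖ₑ * ENNReal.ofReal (min ‖x‖ 1) ^ θ) ^ θ *
       ((1 + 2 * 2 ^ d) * ∫⁻ x, ‖g x‖ₑ * ENNReal.ofReal (min ‖x‖ 1) ^ θ) ^ (1 - θ)) := by
  set W : EuclideanSpace ℝ (Fin d) → ENNReal := fun x => ENNReal.ofReal (min ‖x‖ 1) with hW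
  have hWm : Measurable W := by fun_prop
  have hψc : Continuous ψ :=
    (LipschitzWith.of_dist_le_mul (K := Real.toNNReal κ) fun x y => by
      rw [Real.coe_toNNReal _ h0, dist_eq_norm, dist_eq_norm]; exact hψ x y).continuous
  have hgc : Continuous g := hg.continuous
  have hdc : Continuous (fderiv ℝ g) := hg.continuous_fderiv one_ne_zero
  have hψx : ∀ x, ‖ψ x‖ ≤ κ * ‖x‖ := fun x => by simpa [hψ0] using hψ x 0
  have hψW : ∀ x, ‖ψ x‖ₑ ≤ ENNReal.ofReal (2 * κ) * W x := by
    intro x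
    rw [hW, ← ENNReal.ofReal_mul (by linarith), ← ofReal_norm]
    refine ENNReal.ofReal_le_ofReal ?_
    rcases min_cases ‖x‖ 1 with h | h
    · rw [h.1]; nlinarith [hψx x, norm_nonneg x]
    · rw [h.1]; linarith [hψb x]
  -- weights are comparable along the flow
  have hWT : ∀ s ∈ Icc (0:ℝ) 1, ∀ x, W x ^ θ ≤ 2 * W (x + s • ψ x) ^ θ := by
    intro s hs x
    have hb : W x ≤ 2 * W (x + s • ψ x) := by
      suffices W x ≤ ENNReal.ofReal 2 * W (x + s • ψ x) by simpa using this
      simp only [hW]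
      rw [← ENNReal.ofReal_mul (by norm_num)]
      refine ENNReal.ofReal_le_ofReal ?_
      have h3 : ‖s • ψ x‖ ≤ ‖x‖ / 2 := by
        rw [norm_smul, Real.norm_of_nonneg hs.1]
        nlinarith [hψx x, norm_nonneg (ψ x), hs.2, norm_nonneg x]
      have h4 : ‖x‖ ≤ ‖x + s • ψ x‖ + ‖s • ψ x‖ := by
        calc ‖x‖ = ‖(x + s • ψ x) - s • ψ x‖ := by congr 1; abel
          _ ≤ _ := norm_sub_le _ _
      rcases min_cases ‖x + s • ψ x‖ 1 with h | h
      · rw [h.1]; exact (min_le_left _ _).trans (by linarith)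
      · rw [h.1]; exact (min_le_right _ _).trans (by linarith)
    calc W x ^ θ ≤ (2 * W (x + s • ψ x)) ^ θ := by gcongr
      _ = 2 ^ θ * W (x + s • ψ x) ^ θ := ENNReal.mul_rpow_of_nonneg _ _ hθ0
      _ ≤ 2 ^ (1:ℝ) * W (x + s • ψ x) ^ θ := by
          gcongr
          norm_num
      _ = _ := by rw [ENNReal.rpow_one]
  have hflow : ∀ s ∈ Icc (0:ℝ) 1, ∀ G : EuclideanSpace ℝ (Fin d) → ENNReal, Measurable G →
      ∫⁻ x, G (x + s • ψ x) * W x ^ θ ≤ 2 * 2 ^ d * ∫⁻ x, G x * W x ^ θ := by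
    intro s hs G hG
    have hsψ : ∀ x y, ‖(s • ψ x) - (s • ψ y)‖ ≤ κ * ‖x - y‖ := by
      intro x y
      rw [← smul_sub, norm_smul, Real.norm_of_nonneg hs.1]
      nlinarith [hψ x y, norm_nonneg (ψ x - ψ y), hs.2]
    calc ∫⁻ x, G (x + s • ψ x) * W x ^ θ
        ≤ ∫⁻ x, 2 * (G (x + s • ψ x) * W (x + s • ψ x) ^ θ) := by
          refine lintegral_mono fun x => ?_
          calc G (x + s • ψ x) * W x ^ θ ≤ G (x + s • ψ x) * (2 * W (x + s • ψ x) ^ θ) := by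
                gcongr; exact hWT s hs x
            _ = _ := by ring
      _ = 2 * ∫⁻ x, (fun y => G y * W y ^ θ) (x + s • ψ x) :=
          lintegral_const_mul' _ _ (by norm_num)
      _ ≤ 2 * (2 ^ d * ∫⁻ x, G x * W x ^ θ) := by
          gcongr
          exact aux_lint h0 h1 (ψ := fun x => s • ψ x) hsψ (by fun_prop)
      _ = _ := by ring
  set D : EuclideanSpace ℝ (Fin d) → ENNReal :=
    fun x => ∫⁻ s in Icc (0 : ℝ) 1, ‖fderiv ℝ g (x + s • ψ x)‖ₑ with hD
  have hjoint : Measurable (fun p : EuclideanSpace ℝ (Fin d) × ℝ =>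
      ‖fderiv ℝ g (p.1 + p.2 • ψ p.1)‖ₑ) := by
    apply Continuous.measurable
    fun_prop
  have hDm : Measurable D := hjoint.lintegral_prod_right'
  have hAint : ∫⁻ x, D x * W x ^ θ ≤ 2 * 2 ^ d * ∫⁻ x, ‖fderiv ℝ g x‖ₑ * W x ^ θ := by
    calc ∫⁻ x, D x * W x ^ θ
        = ∫⁻ x, ∫⁻ s in Icc (0 : ℝ) 1, ‖fderiv ℝ g (x + s • ψ x)‖ₑ * W x ^ θ := by
          refine lintegral_congr fun x => ?_
          rw [hD, lintegral_mul_const']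
          exact ENNReal.rpow_ne_top_of_nonneg hθ0 ENNReal.ofReal_ne_top
      _ = ∫⁻ s in Icc (0 : ℝ) 1, ∫⁻ x, ‖fderiv ℝ g (x + s • ψ x)‖ₑ * W x ^ θ := by
          apply lintegral_lintegral_swap
          apply Measurable.aemeasurable
          exact hjoint.mul ((hWm.comp measurable_fst).pow_const θ)
      _ ≤ ∫⁻ s in Icc (0 : ℝ) 1, 2 * 2 ^ d * ∫⁻ x, ‖fderiv ℝ g x‖ₑ * W x ^ θ := by
          refine setLIntegral_mono' measurableSet_Icc fun s hs => ?_
          exact hflow s hs (fun y => ‖fderiv ℝ g y‖ₑ) hdc.enorm.measurable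
      _ = _ := by simp
  have hBint : ∫⁻ x, (‖g x‖ₑ + ‖g (x + ψ x)‖ₑ) * W x ^ θ ≤
      (1 + 2 * 2 ^ d) * ∫⁻ x, ‖g x‖ₑ * W x ^ θ := by
    simp only [add_mul]
    rw [lintegral_add_left (by fun_prop), one_mul]
    gcongr
    have := hflow 1 (by simp) (fun y => ‖g y‖ₑ) (by fun_prop)
    simpa only [one_smul] using this
  have hpt : ∀ x, ‖g (x + ψ x) - g x‖ₑ ≤ ENNReal.ofReal (2 * κ) ^ θ *
      ((D x * W x ^ θ) ^ θ * ((‖g x‖ₑ + ‖g (x + ψ x)‖ₑ) * W x ^ θ) ^ (1 - θ)) := by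
    intro x
    have hθ2 : 0 ≤ 1 - θ := by linarith
    set h := ‖g (x + ψ x) - g x‖ₑ with hh
    have a1 : h ≤ ENNReal.ofReal (2 * κ) * W x * D x :=
      (aux_ftc hg x (ψ x)).trans (by gcongr; exact hψW x)
    have a2 : h ≤ ‖g x‖ₑ + ‖g (x + ψ x)‖ₑ := by
      rw [add_comm]; exact enorm_sub_le
    calc h = h ^ θ * h ^ (1 - θ) := by
          rw [← ENNReal.rpow_add_of_nonneg _ _ hθ0 hθ2]; simp
      _ ≤ (ENNReal.ofReal (2 * κ) * W x * D x) ^ θ * (‖g x‖ₑ + ‖g (x + ψ x)‖ₑ) ^ (1 - θ) := by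
          gcongr
      _ = ENNReal.ofReal (2 * κ) ^ θ * (W x ^ θ) * D x ^ θ *
            (‖g x‖ₑ + ‖g (x + ψ x)‖ₑ) ^ (1 - θ) := by
          rw [ENNReal.mul_rpow_of_nonneg _ _ hθ0, ENNReal.mul_rpow_of_nonneg _ _ hθ0]
      _ = ENNReal.ofReal (2 * κ) ^ θ * ((W x ^ θ) ^ θ * (W x ^ θ) ^ (1 - θ)) * D x ^ θ *
            (‖g x‖ₑ + ‖g (x + ψ x)‖ₑ) ^ (1 - θ) := by
          rw [← ENNReal.rpow_add_of_nonneg _ _ hθ0 hθ2]; simp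
      _ = _ := by
          rw [ENNReal.mul_rpow_of_nonneg _ _ hθ0, ENNReal.mul_rpow_of_nonneg _ _ hθ2]
          ring
  calc ∫⁻ x, ‖g (x + ψ x) - g x‖ₑ ≤ ∫⁻ x, ENNReal.ofReal (2 * κ) ^ θ *
      ((D x * W x ^ θ) ^ θ * ((‖g x‖ₑ + ‖g (x + ψ x)‖ₑ) * W x ^ θ) ^ (1 - θ)) :=
        lintegral_mono hpt
    _ = ENNReal.ofReal (2 * κ) ^ θ * ∫⁻ x, 
      ((D x * W x ^ θ) ^ θ * ((‖g x‖ₑ + ‖g (x + ψ x)‖ₑ) * W x ^ θ) ^ (1 - θ)) :=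
        lintegral_const_mul' _ _ (ENNReal.rpow_ne_top_of_nonneg hθ0 ENNReal.ofReal_ne_top)
    _ ≤ ENNReal.ofReal (2 * κ) ^ θ * ((∫⁻ x, D x * W x ^ θ) ^ θ *
        (∫⁻ x, (‖g x‖ₑ + ‖g (x + ψ x)‖ₑ) * W x ^ θ) ^ (1 - θ)) := by
        gcongr
        refine ENNReal.lintegral_mul_norm_pow_le ?_ ?_ hθ0 (by linarith) (by ring)
        · fun_prop
        · fun_prop
    _ ≤ _ := by
        have hθ2 : 0 ≤ 1 - θ := by linarith
        gcongr

theorem aux_pow_up (d : ℕ) {κ : ℝ} (h0 : 0 ≤ κ) (h1 : κ ≤ 1 / 2) :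
    (1 + κ) ^ d ≤ 1 + 3 ^ d * κ := by
  induction d with
  | zero => simp [h0]
  | succ n ih =>
    have h3 : (1 : ℝ) ≤ 3 ^ n := one_le_pow₀ (by norm_num)
    rw [pow_succ, pow_succ]
    have : (1 + κ) ^ n * (1 + κ) ≤ (1 + 3 ^ n * κ) * (1 + κ) := by gcongr
    refine this.trans ?_
    nlinarith [mul_nonneg h0 (sub_nonneg.2 h3), mul_nonneg (mul_nonneg h0 (by linarith : (0:ℝ) ≤ 3 ^ n)) (sub_nonneg.2 h1)]

theorem aux_pow_lo (d : ℕ) {κ : ℝ} (h0 : 0 ≤ κ) (h1 : κ ≤ 1 / 2) :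
    1 - 3 ^ d * κ ≤ (1 - κ) ^ d := by
  have h := one_add_mul_le_pow (a := -κ) (by linarith) d
  have hd : (d : ℝ) ≤ 3 ^ d := by exact_mod_cast (Nat.lt_pow_self (by norm_num : 1 < 3)).le
  rw [← sub_eq_add_neg] at h
  nlinarith [mul_le_mul_of_nonneg_right hd h0]

theorem aux_compare {α : Type*} [MeasurableSpace α] {μ ν : Measure α} {a b c : ℝ}
    (ha : 0 ≤ a) (hb : 0 ≤ b)
    (hac : 1 - c ≤ a) (hbc : b ≤ 1 + c) (h1 : ν ≤ ENNReal.ofReal b • μ)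
    (h2 : ENNReal.ofReal a • μ ≤ ν) {F : α → ℝ} (hF : Integrable F μ) :
    |(∫ x, F x ∂μ) - ∫ x, F x ∂ν| ≤ c * ∫ x, |F x| ∂μ := by
  have hFν : Integrable F ν := (hF.smul_measure ENNReal.ofReal_ne_top).mono_measure h1
  have key : ∀ G : α → ℝ, (∀ x, 0 ≤ G x) → Integrable G μ →
      (1 - c) * ∫ x, G x ∂μ ≤ ∫ x, G x ∂ν ∧ ∫ x, G x ∂ν ≤ (1 + c) * ∫ x, G x ∂μ := by
    intro G hG hGi
    have hI : 0 ≤ ∫ x, G x ∂μ := integral_nonneg hG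
    have hGν : Integrable G ν := (hGi.smul_measure ENNReal.ofReal_ne_top).mono_measure h1
    constructor
    · have := integral_mono_measure h2 (Filter.Eventually.of_forall hG) hGν
      rw [integral_smul_measure, ENNReal.toReal_ofReal ha, smul_eq_mul] at this
      exact (mul_le_mul_of_nonneg_right hac hI).trans this
    · have := integral_mono_measure h1 (Filter.Eventually.of_forall hG)
        (hGi.smul_measure ENNReal.ofReal_ne_top)
      rw [integral_smul_measure, ENNReal.toReal_ofReal hb, smul_eq_mul] at this
      exact this.trans (mul_le_mul_of_nonneg_right hbc hI)
  obtain ⟨p1, p2⟩ := key (fun x => max (F x) 0) (fun x => le_max_right _ _) hF.pos_part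
  obtain ⟨n1, n2⟩ := key (fun x => max (-F x) 0) (fun x => le_max_right _ _) hF.neg_part
  have e1 : ∀ x, F x = max (F x) 0 - max (-F x) 0 := fun x => by
    rcases le_total 0 (F x) with h | h
    · rw [max_eq_left h, max_eq_right (by linarith)]; ring
    · rw [max_eq_right h, max_eq_left (by linarith)]; ring
  have e2 : ∀ x, |F x| = max (F x) 0 + max (-F x) 0 := fun x => by
    rcases le_total 0 (F x) with h | h
    · rw [max_eq_left h, max_eq_right (by linarith), abs_of_nonneg h]; ring
    · rw [max_eq_right h, max_eq_left (by linarith), abs_of_nonpos h]; ring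
  have i1 : ∫ x, F x ∂μ = (∫ x, max (F x) 0 ∂μ) - ∫ x, max (-F x) 0 ∂μ := by
    rw [← integral_sub hF.pos_part hF.neg_part]
    exact integral_congr_ae (Filter.Eventually.of_forall e1)
  have i2 : ∫ x, F x ∂ν = (∫ x, max (F x) 0 ∂ν) - ∫ x, max (-F x) 0 ∂ν := by
    rw [← integral_sub hFν.pos_part hFν.neg_part]
    exact integral_congr_ae (Filter.Eventually.of_forall e1)
  have i3 : ∫ x, |F x| ∂μ = (∫ x, max (F x) 0 ∂μ) + ∫ x, max (-F x) 0 ∂μ := by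
    rw [← integral_add hF.pos_part hF.neg_part]
    exact integral_congr_ae (Filter.Eventually.of_forall e2)
  rw [i1, i2, i3, abs_le]
  constructor <;> nlinarith

theorem aux_weight {d : ℕ} {θ : ℝ} (hθ0 : 0 ≤ θ) {h : EuclideanSpace ℝ (Fin d) → ℝ}
    (h0 : ∀ x, 0 ≤ h x) (hi : Integrable h) :
    ∫⁻ x, ENNReal.ofReal (h x) * ENNReal.ofReal (min ‖x‖ 1) ^ θ =
      ENNReal.ofReal (∫ x, h x * (min ‖x‖ 1) ^ θ) := by
  have hw : ∀ x : EuclideanSpace ℝ (Fin d), 0 ≤ min ‖x‖ 1 := fun x =>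
    le_min (norm_nonneg x) zero_le_one
  rw [ofReal_integral_eq_lintegral_ofReal]
  · refine lintegral_congr fun x => ?_
    rw [ENNReal.ofReal_mul (h0 x), ENNReal.ofReal_rpow_of_nonneg (hw x) hθ0]
  · refine hi.mul_bdd (c := 1) ?_ (Filter.Eventually.of_forall fun x => ?_)
    · apply Measurable.aestronglyMeasurable
      fun_prop
    · rw [Real.norm_of_nonneg (Real.rpow_nonneg (hw x) _)]
      exact Real.rpow_le_one (hw x) (min_le_right _ _) hθ0
  · exact Filter.Eventually.of_forall fun x => mul_nonneg (h0 x) (Real.rpow_nonneg (hw x) _)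

/-- Estimate (2.6) of the paper: bound on `⟨𝒟^φ₀ f, g⟩` where
`𝒟^φ₀ f(x) = f(x+φ(x)) − f(x+φ(0))`. Here `μ_θ(h) = ∫ h(x) (|x|∧1)^θ dx`. -/
theorem stmt9 (d : ℕ) (θ : ℝ) (hθ : θ ∈ Set.Icc (0 : ℝ) 1) :
    ∃ C > 0, ∀ (φ : EuclideanSpace ℝ (Fin d) → EuclideanSpace ℝ (Fin d)) (κ : ℝ),
      0 ≤ κ → κ ≤ 1 / 2 →
      (∀ x, ‖φ x‖ ≤ κ) →
      (∀ x y, ‖φ x - φ y‖ ≤ κ * ‖x - y‖) →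
      ∀ (f : EuclideanSpace ℝ (Fin d) → ℝ) (M : ℝ), Measurable f →
        (∀ x, |f x| ≤ M) →
        ∀ (g : EuclideanSpace ℝ (Fin d) → ℝ), ContDiff ℝ 1 g →
          Integrable g → Integrable (fun x => fderiv ℝ g x) →
          |∫ x, (f (x + φ x) - f (x + φ 0)) * g x| ≤
            C * κ ^ θ * M *
              ((∫ x, |g x|) +
                (∫ x, ‖fderiv ℝ g x‖ * (min ‖x‖ 1) ^ θ) ^ θ *
                  (∫ x, |g x| * (min ‖x‖ 1) ^ θ) ^ (1 - θ)) := by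
  obtain ⟨hθ0, hθ1⟩ := hθ
  have hθ2 : 0 ≤ 1 - θ := by linarith
  refine ⟨3 ^ d + 2 ^ d * (2 * ((2 * 2 ^ d) * (1 + 2 * 2 ^ d))), by positivity, ?_⟩
  intro φ κ h0 h1 hφb hφ f M hf hfM g hg hgi hdi
  have hM : 0 ≤ M := (abs_nonneg _).trans (hfM 0)
  obtain ⟨e, he⟩ := aux_homeo h0 h1 hφ
  have hup := aux_nu_le h0 hφ e he
  have hlo := aux_le_nu h1 hφ e he
  set ν := Measure.map e.symm.toMeasurableEquiv
    (volume : Measure (EuclideanSpace ℝ (Fin d))) with hν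
  set ψ : EuclideanSpace ℝ (Fin d) → EuclideanSpace ℝ (Fin d) := fun x => φ x - φ 0 with hψdef
  have hψ : ∀ x y, ‖ψ x - ψ y‖ ≤ κ * ‖x - y‖ := fun x y => by
    simpa [hψdef] using hφ x y
  have hψb : ∀ x, ‖ψ x‖ ≤ 2 * κ := fun x =>
    (norm_sub_le _ _).trans (by linarith [hφb x, hφb 0])
  have hmain := aux_main hθ0 hθ1 h0 h1 hψ (by simp [hψdef]) hψb hg
  set I1 := ∫ x, ‖fderiv ℝ g x‖ * (min ‖x‖ 1) ^ θ with hI1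
  set I2 := ∫ x, |g x| * (min ‖x‖ 1) ^ θ with hI2
  have hw : ∀ x : EuclideanSpace ℝ (Fin d), 0 ≤ min ‖x‖ 1 := fun x =>
    le_min (norm_nonneg x) zero_le_one
  have hI1n : 0 ≤ I1 := integral_nonneg fun x => 
    mul_nonneg (norm_nonneg _) (Real.rpow_nonneg (hw x) _)
  have hI2n : 0 ≤ I2 := integral_nonneg fun x => 
    mul_nonneg (abs_nonneg _) (Real.rpow_nonneg (hw x) _)
  have w1 : ∫⁻ x, ‖fderiv ℝ g x‖ₑ * ENNReal.ofReal (min ‖x‖ 1) ^ θ = ENNReal.ofReal I1 := by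
    rw [hI1, ← aux_weight hθ0 (fun x => norm_nonneg (fderiv ℝ g x)) hdi.norm]
    simp only [ofReal_norm]
  have w2 : ∫⁻ x, ‖g x‖ₑ * ENNReal.ofReal (min ‖x‖ 1) ^ θ = ENNReal.ofReal I2 := by
    rw [hI2, ← aux_weight hθ0 (fun x => abs_nonneg (g x)) hgi.abs]
    simp only [← Real.norm_eq_abs, ofReal_norm]
  rw [w1, w2] at hmain
  have hmain2 : ∫⁻ x, ‖g (x + ψ x) - g x‖ₑ ≤ ENNReal.ofReal
      ((2 * ((2 * 2 ^ d) * (1 + 2 * 2 ^ d))) * (κ ^ θ * (I1 ^ θ * I2 ^ (1 - θ)))) := by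
    have c1 : (2 * 2 ^ d : ENNReal) = ENNReal.ofReal (2 * 2 ^ d) := by
      rw [ENNReal.ofReal_mul (by norm_num), ENNReal.ofReal_pow (by norm_num)]; simp
    have c2 : (1 + 2 * 2 ^ d : ENNReal) = ENNReal.ofReal (1 + 2 * 2 ^ d) := by
      rw [ENNReal.ofReal_add (by norm_num) (by positivity), ← c1]; simp
    refine hmain.trans ?_
    rw [c2, c1, ← ENNReal.ofReal_mul (by positivity), ← ENNReal.ofReal_mul (by positivity),
      ENNReal.ofReal_rpow_of_nonneg (by positivity) hθ0,
      ENNReal.ofReal_rpow_of_nonneg (by positivity) hθ0,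
      ENNReal.ofReal_rpow_of_nonneg (by positivity) hθ2,
      ← ENNReal.ofReal_mul (by positivity), ← ENNReal.ofReal_mul (by positivity)]
    refine ENNReal.ofReal_le_ofReal ?_
    have hp : (1:ℝ) ≤ 2 ^ d := one_le_pow₀ (by norm_num)
    have hself : ∀ a t : ℝ, 1 ≤ a → t ≤ 1 → a ^ t ≤ a := fun a t ha ht => by
      simpa using Real.rpow_le_rpow_of_exponent_le ha ht
    rw [Real.mul_rpow (by norm_num) h0, Real.mul_rpow (by positivity) hI1n,
      Real.mul_rpow (by positivity) hI2n]
    calc (2:ℝ) ^ θ * κ ^ θ * ((2 * 2 ^ d) ^ θ * I1 ^ θ * ((1 + 2 * 2 ^ d) ^ (1 - θ) * I2 ^ (1 - θ)))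
        ≤ 2 * κ ^ θ * ((2 * 2 ^ d) * I1 ^ θ * ((1 + 2 * 2 ^ d) * I2 ^ (1 - θ))) := by
          gcongr
          · exact hself _ _ (by norm_num) hθ1
          · exact hself _ _ (by linarith) hθ1
          · exact hself _ _ (by linarith) (by linarith)
      _ = _ := by ring
  -- integrability
  have hec : Measurable (fun x => f (e x)) := hf.comp e.continuous.measurable
  have hF1 : Integrable (fun x => f (e x) * g x) :=
    hgi.bdd_mul (c := M) hec.aestronglyMeasurable (Filter.Eventually.of_forall fun x => hfM _)
  have hF2 : Integrable (fun x => f (x + φ 0) * g x) :=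
    hgi.bdd_mul (c := M) (hf.comp (measurable_add_const _)).aestronglyMeasurable
      (Filter.Eventually.of_forall fun x => hfM _)
  have hF1ν : Integrable (fun x => f (e x) * g x) ν :=
    (hF1.smul_measure ENNReal.ofReal_ne_top).mono_measure hup
  have hshift : ∀ x, x + ψ x = e x - φ 0 := fun x => by
    rw [he, hψdef]; simp only; abel
  have hH : Integrable (fun y => f y * g (y - φ 0)) := by
    simpa using hF2.comp_sub_right (φ 0)
  have hHν : Integrable (fun x => f (e x) * g (x + ψ x)) ν := by
    rw [hν, integrable_map_equiv]
    refine hH.congr (Filter.Eventually.of_forall fun y => ?_)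
    simp [hshift]
  have hHI : ∫ x, f (x + φ 0) * g x = ∫ x, f (e x) * g (x + ψ x) ∂ν := by
    rw [hν, integral_map_equiv]
    rw [← integral_sub_right_eq_self _ (φ 0)]
    refine integral_congr_ae (Filter.Eventually.of_forall fun y => ?_)
    simp [hshift]
  have hsplit : ∫ x, (f (x + φ x) - f (x + φ 0)) * g x =
      ((∫ x, f (e x) * g x) - ∫ x, f (e x) * g x ∂ν) -
        ∫ x, f (e x) * (g (x + ψ x) - g x) ∂ν := by
    have q1 : ∫ x, f (e x) * (g (x + ψ x) - g x) ∂ν =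
        (∫ x, f (e x) * g (x + ψ x) ∂ν) - ∫ x, f (e x) * g x ∂ν := by
      rw [← integral_sub hHν hF1ν]
      simp only [mul_sub]
    rw [q1, ← hHI]
    have q2 : ∫ x, (f (x + φ x) - f (x + φ 0)) * g x =
        (∫ x, f (e x) * g x) - ∫ x, f (x + φ 0) * g x := by
      rw [← integral_sub hF1 hF2]
      simp only [sub_mul, he]
    rw [q2]; ring
  have hfirst : |(∫ x, f (e x) * g x) - ∫ x, f (e x) * g x ∂ν| ≤
      3 ^ d * κ ^ θ * (M * ∫ x, |g x|) := by
    refine (aux_compare (pow_nonneg (by linarith) d) (pow_nonneg (by linarith) d)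
      (aux_pow_lo d h0 h1) (aux_pow_up d h0 h1) hup hlo hF1).trans ?_
    have r1 : ∫ x, |f (e x) * g x| ≤ M * ∫ x, |g x| := by
      rw [← integral_const_mul]
      refine integral_mono hF1.abs (hgi.abs.const_mul M) fun x => ?_
      simp only [abs_mul]
      exact mul_le_mul_of_nonneg_right (hfM _) (abs_nonneg _)
    have r2 : κ ≤ κ ^ θ := by
      have := Real.rpow_le_rpow_of_exponent_ge' h0 (by linarith) hθ0 hθ1
      simpa using this
    have : 0 ≤ ∫ x, |f (e x) * g x| := integral_nonneg fun x => abs_nonneg _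
    gcongr
  have hsecond : |∫ x, f (e x) * (g (x + ψ x) - g x) ∂ν| ≤
      M * (2 ^ d * ((2 * ((2 * 2 ^ d) * (1 + 2 * 2 ^ d))) *
        (κ ^ θ * (I1 ^ θ * I2 ^ (1 - θ))))) := by
    rw [← ENNReal.ofReal_le_ofReal_iff (by positivity), ← Real.norm_eq_abs, ofReal_norm]
    refine (enorm_integral_le_lintegral_enorm _).trans ?_
    have hup2 : ν ≤ ENNReal.ofReal (2 ^ d) • (volume : Measure (EuclideanSpace ℝ (Fin d))) := by
      refine hup.trans ?_
      gcongr
      linarith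
    calc ∫⁻ x, ‖f (e x) * (g (x + ψ x) - g x)‖ₑ ∂ν
        ≤ ∫⁻ x, ENNReal.ofReal M * ‖g (x + ψ x) - g x‖ₑ ∂ν := by
          refine lintegral_mono fun x => ?_
          rw [enorm_mul, ← ofReal_norm (f (e x))]
          gcongr
          exact hfM _
      _ = ENNReal.ofReal M * ∫⁻ x, ‖g (x + ψ x) - g x‖ₑ ∂ν :=
          lintegral_const_mul' _ _ ENNReal.ofReal_ne_top
      _ ≤ ENNReal.ofReal M * ∫⁻ x, ‖g (x + ψ x) - g x‖ₑ ∂(ENNReal.ofReal (2 ^ d) •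
            (volume : Measure (EuclideanSpace ℝ (Fin d)))) := by
          gcongr
      _ = ENNReal.ofReal M * (ENNReal.ofReal (2 ^ d) * ∫⁻ x, ‖g (x + ψ x) - g x‖ₑ) := by
          rw [lintegral_smul_measure, smul_eq_mul]
      _ ≤ _ := by
          rw [ENNReal.ofReal_mul hM, ENNReal.ofReal_mul (p := (2:ℝ) ^ d) (by positivity)]
          gcongr
  rw [hsplit]
  refine (abs_sub _ _).trans ((add_le_add hfirst hsecond).trans ?_)
  have hgn : 0 ≤ ∫ x, |g x| := integral_nonneg fun x => abs_nonneg _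
  have hκ : 0 ≤ κ ^ θ := Real.rpow_nonneg h0 _
  have s1 : 0 ≤ 3 ^ d * κ ^ θ * M * (I1 ^ θ * I2 ^ (1 - θ)) := by positivity
  have s2 : 0 ≤ 2 ^ d * (2 * ((2 * 2 ^ d) * (1 + 2 * 2 ^ d))) * κ ^ θ * M * (∫ x, |g x|) := by
    positivity
  linarith
end

section
/- Let φ: ℝ^d → ℝ^d satisfy ‖φ‖_∞ ≤ κ and ‖∇φ‖_∞ ≤ κ with κ ≤ 1/2. For θ ∈ [0,1] there is C = C(d,θ) > 0 such that for any f ∈ C^θ bounded with finite θ-Hölder seminorm and any g ∈ C²(ℝ^d) with g, ∇g, ∇²g ∈ L¹(ℝ^d), |∫ (f(x+φ(x)) − f(x+φ(0)) − (φ(x)−φ(0))·∇f(x)) g(x) dx| ≤ C κ^{1+θ} ‖f‖_{C^θ} ( μ₀(|g|) + μ₁(|∇g|) + μ_{1+θ}(|∇²g|)^θ μ_{1+θ}(|∇g|)^{1−θ} ), where μ_θ(h) = ∫ h(x)(|x|∧1)^θ dx and f is additionally assumed C¹ so the pairing is well defined. -/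
open MeasureTheory Set

abbrev EE (d : ℕ) := EuclideanSpace ℝ (Fin d)

lemma clm_det_eq (d : ℕ) (A : EE d →L[ℝ] EE d) :
    (1 + A).det = Matrix.det (1 + LinearMap.toMatrix (EuclideanSpace.basisFun (Fin d) ℝ).toBasis
      (EuclideanSpace.basisFun (Fin d) ℝ).toBasis (A : EE d →ₗ[ℝ] EE d)) := by
  rw [ContinuousLinearMap.det, ← LinearMap.det_toMatrix (EuclideanSpace.basisFun (Fin d) ℝ).toBasis]
  congr 1
  rw [ContinuousLinearMap.toLinearMap_add, map_add]
  congr 1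
  exact LinearMap.toMatrix_one _

lemma toMatrix_entry (d : ℕ) (A : EE d →L[ℝ] EE d) (i j : Fin d) :
    LinearMap.toMatrix (EuclideanSpace.basisFun (Fin d) ℝ).toBasis
      (EuclideanSpace.basisFun (Fin d) ℝ).toBasis (A : EE d →ₗ[ℝ] EE d) i j
      = (A (EuclideanSpace.single j 1)) i := by
  simp [LinearMap.toMatrix_apply]

lemma det_bound0 (d : ℕ) : ∃ C : ℝ, 0 ≤ C ∧ ∀ A : EE d →L[ℝ] EE d, ‖A‖ ≤ 1 / 2 →
    |(1 + A).det - (1 + ∑ i, (A (EuclideanSpace.single i 1)) i)| ≤ C * ‖A‖ ^ 2 := by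
  set F : (EE d →L[ℝ] EE d) → ℝ := fun A => (1 + A).det with hF
  have hFc : ContDiff ℝ 2 F := by
    have : F = fun A => ∑ σ : Equiv.Perm (Fin d), (Equiv.Perm.sign σ : ℤ) •
        ∏ i, ((1 : Matrix (Fin d) (Fin d) ℝ) (σ i) i + (A (EuclideanSpace.single i 1)) (σ i)) := by
      funext A
      simp only [hF]
      rw [clm_det_eq, Matrix.det_apply]
      simp only [Matrix.add_apply, toMatrix_entry]
      rfl
    rw [this]
    refine ContDiff.sum fun σ _ => ?_
    simp only [zsmul_eq_mul]
    refine contDiff_const.mul (contDiff_prod fun i _ => contDiff_const.add ?_)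
    have := ((EuclideanSpace.proj (σ i) : EE d →L[ℝ] ℝ).comp
      (ContinuousLinearMap.apply ℝ (EE d) (EuclideanSpace.single i (1:ℝ) : EE d))).contDiff (n := 2)
    exact this
  have hF' : ContDiff ℝ 1 (fderiv ℝ F) := hFc.fderiv_right (by norm_num)
  have hder : ∀ A, fderiv ℝ F 0 A = ∑ i, (A (EuclideanSpace.single i 1)) i := by
    intro A
    have h1 : HasDerivAt (fun t : ℝ => F (t • A)) (fderiv ℝ F 0 A) 0 := by
      have h2 : HasFDerivAt F (fderiv ℝ F 0) ((0:ℝ) • A) := by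
        have e : (0:ℝ) • A = 0 := by ext; simp
        rw [e]; exact (hFc.differentiable (by norm_num) 0).hasFDerivAt
      have h3 : HasDerivAt (fun t : ℝ => t • A) A 0 := by
        simpa using (hasDerivAt_id (0:ℝ)).smul_const A
      exact h2.comp_hasDerivAt 0 h3
    have h4 : HasDerivAt (fun t : ℝ => F (t • A)) (∑ i, (A (EuclideanSpace.single i 1)) i) 0 := by
      set Mt := LinearMap.toMatrix (EuclideanSpace.basisFun (Fin d) ℝ).toBasis
        (EuclideanSpace.basisFun (Fin d) ℝ).toBasis (A : EE d →ₗ[ℝ] EE d) with hMt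
      have h5 : (fun t : ℝ => F (t • A)) = fun t => 1 + Matrix.trace Mt * t +
        (Matrix.det (1 + (Polynomial.X : Polynomial ℝ) • Mt.map Polynomial.C)).divX.divX.eval t * t ^ 2 := by
        funext t
        rw [← Matrix.det_one_add_smul]
        simp only [hF]
        rw [clm_det_eq]
        simp [hMt]
      rw [h5]
      have ht : Matrix.trace Mt = ∑ i, (A (EuclideanSpace.single i 1)) i := by
        simp only [Matrix.trace, Matrix.diag, hMt, toMatrix_entry]
      rw [← ht]
      set p := (Matrix.det (1 + (Polynomial.X : Polynomial ℝ) • Mt.map Polynomial.C)).divX.divX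
      have := (((hasDerivAt_id (0:ℝ)).const_mul (Matrix.trace Mt)).const_add 1).add
        ((p.hasDerivAt 0).mul ((hasDerivAt_id (0:ℝ)).pow 2))
      have e : Matrix.trace Mt = Matrix.trace Mt * 1 + (Polynomial.eval 0 (Polynomial.derivative p) * (id ^ 2 : ℝ → ℝ) 0 +
        Polynomial.eval 0 p * (((2:ℕ):ℝ) * (id (0:ℝ)) ^ (2 - 1) * 1)) := by simp
      exact this.congr_deriv e.symm
    exact h1.unique h4
  have hcomp : IsCompact (Metric.closedBall (0 : EE d →L[ℝ] EE d) (1/2)) := isCompact_closedBall _ _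
  obtain ⟨K, hK⟩ := hcomp.exists_bound_of_continuousOn
    ((hF'.continuous_fderiv (by norm_num)).continuousOn)
  refine ⟨|K|, abs_nonneg _, fun A hA => ?_⟩
  have hlip : ∀ B ∈ Metric.closedBall (0 : EE d →L[ℝ] EE d) (1/2),
      ‖fderiv ℝ F B - fderiv ℝ F 0‖ ≤ |K| * ‖B‖ := by
    intro B hB
    have := (convex_closedBall (0 : EE d →L[ℝ] EE d) (1/2)).norm_image_sub_le_of_norm_fderiv_le
      (f := fderiv ℝ F) (C := |K|) (fun x _ => hF'.differentiable (by norm_num) x)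
      (fun x hx => (hK x hx).trans (le_abs_self _)) (Metric.mem_closedBall_self (by norm_num)) hB
    simpa using this
  have hsub : ∀ B ∈ Metric.closedBall (0 : EE d →L[ℝ] EE d) ‖A‖,
      B ∈ Metric.closedBall (0 : EE d →L[ℝ] EE d) (1/2) := by
    intro B hB; exact Metric.closedBall_subset_closedBall hA hB
  have := (convex_closedBall (0 : EE d →L[ℝ] EE d) ‖A‖).norm_image_sub_le_of_norm_fderiv_le'
      (f := F) (C := |K| * ‖A‖) (φ := fderiv ℝ F 0) (x := 0) (y := A)
      (fun x _ => hFc.differentiable (by norm_num) x)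
      (fun x hx => (hlip x (hsub x hx)).trans (by
        have : ‖x‖ ≤ ‖A‖ := by simpa using hx
        gcongr)) (Metric.mem_closedBall_self (by positivity)) (by simp)
  have h0 : F 0 = 1 := by simp [hF, ContinuousLinearMap.det]
  rw [sub_zero, hder, h0, Real.norm_eq_abs] at this
  calc _ = |F A - 1 - ∑ i, (A (EuclideanSpace.single i 1)) i| := by rw [sub_sub]
    _ ≤ _ := this
    _ = _ := by ring

lemma det_bound (d : ℕ) : ∃ C : ℝ, 0 ≤ C ∧ ∀ A : EE d →L[ℝ] EE d, ‖A‖ ≤ 1 / 2 →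
    |(|(1 + A).det|) - (1 + ∑ i, (A (EuclideanSpace.single i 1)) i)| ≤ C * ‖A‖ ^ 2 := by
  obtain ⟨C, hC, h⟩ := det_bound0 d
  refine ⟨C + 2 * d ^ 2, by positivity, fun A hA => ?_⟩
  have h1 := h A hA
  have h2 : |∑ i, (A (EuclideanSpace.single i 1)) i| ≤ d * ‖A‖ := by
    calc _ ≤ ∑ i, |(A (EuclideanSpace.single i 1)) i| := Finset.abs_sum_le_sum_abs _ _
      _ ≤ ∑ i : Fin d, ‖A‖ := Finset.sum_le_sum fun i _ => by
          calc _ ≤ ‖A (EuclideanSpace.single i 1)‖ := by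
                simpa using PiLp.norm_apply_le (A (EuclideanSpace.single i 1)) i
            _ ≤ ‖A‖ * ‖(EuclideanSpace.single i (1:ℝ) : EE d)‖ := A.le_opNorm _
            _ = ‖A‖ := by simp
      _ = _ := by simp
  set x := (1 + A).det
  set s := ∑ i, (A (EuclideanSpace.single i 1)) i
  have h3 : |(|x|) - (1 + s)| ≤ |x - (1 + s)| + (|1 + s| - (1 + s)) := by
    have e1 := abs_abs_sub_abs_le_abs_sub x (1+s)
    have e2 := le_abs_self (1 + s)
    have : |x| - (1+s) = (|x| - |1+s|) + (|1+s| - (1+s)) := by ring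
    rw [this]
    refine (abs_add_le _ _).trans ?_
    rw [abs_of_nonneg (sub_nonneg.2 e2)]
    gcongr
  have h4 : |1 + s| - (1 + s) ≤ 2 * d ^ 2 * ‖A‖ ^ 2 := by
    rcases le_or_gt 0 (1 + s) with h | h
    · rw [abs_of_nonneg h, sub_self]; positivity
    · rw [abs_of_neg h]
      have := (abs_le.1 h2).1
      nlinarith
  nlinarith

open scoped ENNReal NNReal in
lemma vol_bound (d : ℕ) {P : EE d → EE d} (hP : AntilipschitzWith 2 P) (s : Set (EE d)) :
    volume (P ⁻¹' s) ≤ 2 ^ d * volume s := by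
  have h : (volume : Measure (EE d)) = Measure.addHaarScalarFactor (volume : Measure (EE d)) μH[(d:ℝ)] • μH[(d:ℝ)] := by
    have : (μH[(d:ℝ)] : Measure (EE d)).IsAddHaarMeasure := by
      simpa using MeasureTheory.isAddHaarMeasure_hausdorffMeasure (E := EuclideanSpace ℝ (Fin d))
    exact Measure.isAddLeftInvariant_eq_smul _ _
  rw [h]
  simp only [Measure.smul_apply]
  have := hP.hausdorffMeasure_preimage_le (d := (d:ℝ)) (by positivity) s
  simp only [ENNReal.rpow_natCast, ENNReal.coe_ofNat] at this
  simp only [ENNReal.smul_def, smul_eq_mul]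
  rw [mul_left_comm]
  gcongr

lemma null_image (d : ℕ) {P : EE d → EE d} {K : NNReal} (hP : LipschitzWith K P) (s : Set (EE d))
    (hs : volume s = 0) : volume (P '' s) = 0 := by
  have : (Measure.hausdorffMeasure (d:ℝ) : Measure (EE d)).IsAddHaarMeasure := by
      simpa using MeasureTheory.isAddHaarMeasure_hausdorffMeasure (E := EuclideanSpace ℝ (Fin d))
  have h2 : (Measure.hausdorffMeasure (d:ℝ) : Measure (EE d)) s = 0 :=
    Measure.absolutelyContinuous_isAddHaarMeasure _ volume hs 
  have h3 := hP.hausdorffMeasure_image_le (d := (d:ℝ)) (by positivity) s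
  rw [h2, mul_zero] at h3
  exact Measure.absolutelyContinuous_isAddHaarMeasure volume _ (le_antisymm h3 bot_le)

lemma sub_le_shift {d : ℕ} {ψ : EE d → EE d} {κ : ℝ} (h1 : κ ≤ 1 / 2)
    (hlip : ∀ x y, ‖ψ x - ψ y‖ ≤ κ * ‖x - y‖) {t : ℝ} (ht : t ∈ Icc (0:ℝ) 1) (x y : EE d) :
    ‖x - y‖ ≤ 2 * ‖(x + t • ψ x) - (y + t • ψ y)‖ := by
  have e : x - y = ((x + t • ψ x) - (y + t • ψ y)) - t • (ψ x - ψ y) := by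
    rw [smul_sub]; abel
  have h2 : ‖t • (ψ x - ψ y)‖ ≤ 1 / 2 * ‖x - y‖ := by
    rw [norm_smul, Real.norm_eq_abs, abs_of_nonneg ht.1]
    calc t * ‖ψ x - ψ y‖ ≤ 1 * (κ * ‖x - y‖) := by
          gcongr
          · exact ht.2
          · exact hlip x y
      _ ≤ _ := by rw [one_mul]; gcongr
  have h3 : ‖x - y‖ ≤ ‖(x + t • ψ x) - (y + t • ψ y)‖ + ‖t • (ψ x - ψ y)‖ := by
    conv_lhs => rw [e]
    exact norm_sub_le _ _
  linarith

lemma antilip {d : ℕ} {ψ : EE d → EE d} {κ : ℝ} (h0 : 0 ≤ κ) (h1 : κ ≤ 1 / 2)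
    (hlip : ∀ x y, ‖ψ x - ψ y‖ ≤ κ * ‖x - y‖) {t : ℝ} (ht : t ∈ Icc (0:ℝ) 1) :
    AntilipschitzWith 2 (fun x => x + t • ψ x) := by
  refine AntilipschitzWith.of_le_mul_dist fun x y => ?_
  rw [dist_eq_norm, dist_eq_norm]
  exact sub_le_shift h1 hlip ht x y

lemma psi_le {d : ℕ} {ψ : EE d → EE d} {κ : ℝ} (h0 : 0 ≤ κ) (h1 : κ ≤ 1 / 2)
    (hlip : ∀ x y, ‖ψ x - ψ y‖ ≤ κ * ‖x - y‖) (hz : ψ 0 = 0) (hb : ∀ x, ‖ψ x‖ ≤ 2 * κ)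
    {t : ℝ} (ht : t ∈ Icc (0:ℝ) 1) (x : EE d) :
    ‖ψ x‖ ≤ 4 * κ * min ‖x + t • ψ x‖ 1 := by
  have h2 := hb x
  have h3 := hlip x 0
  have h4 := sub_le_shift h1 hlip ht x 0
  simp only [hz, sub_zero, smul_zero, add_zero] at h3 h4
  rcases min_cases ‖x + t • ψ x‖ 1 with ⟨h, _⟩ | ⟨h, _⟩ <;> rw [h]
  · nlinarith [norm_nonneg (x + t • ψ x)]
  · linarith

lemma map_le {d : ℕ} {P : EE d → EE d} (hP : AntilipschitzWith 2 P) (hc : Continuous P) :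
    Measure.map P volume ≤ (2 ^ d : ENNReal) • (volume : Measure (EE d)) := by
  refine Measure.le_iff.2 fun s hs => ?_
  rw [Measure.map_apply hc.measurable hs]
  simpa using vol_bound d hP s

lemma lint_comp_le {d : ℕ} {P : EE d → EE d} (hP : AntilipschitzWith 2 P) (hc : Continuous P)
    {w : EE d → ENNReal} (hw : Measurable w) :
    ∫⁻ x, w (P x) ≤ 2 ^ d * ∫⁻ x, w x := by
  rw [← lintegral_map hw hc.measurable]
  refine (lintegral_mono' (map_le hP hc) le_rfl).trans ?_
  rw [lintegral_smul_measure, smul_eq_mul]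

lemma integrable_comp {d : ℕ} {P : EE d → EE d} (hP : AntilipschitzWith 2 P) (hc : Continuous P)
    {u : EE d → ℝ} (hu : Integrable u) : Integrable (fun x => u (P x)) := by
  have h : Integrable u (Measure.map P volume) :=
    (hu.smul_measure (c := 2 ^ d) (by simp)).mono_measure (map_le hP hc)
  exact h.comp_measurable hc.measurable

lemma integral_abs_comp_le {d : ℕ} {P : EE d → EE d} (hP : AntilipschitzWith 2 P) (hc : Continuous P)
    {u : EE d → ℝ} (huc : Continuous u) (hu : Integrable u) :
    ∫ x, |u (P x)| ≤ 2 ^ d * ∫ x, |u x| := by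
  have h1 := integrable_comp hP hc hu
  have := lint_comp_le hP hc (w := fun x => ENNReal.ofReal |u x|) (by fun_prop)
  rw [← ofReal_integral_eq_lintegral_ofReal h1.abs (.of_forall fun _ => abs_nonneg _),
    ← ofReal_integral_eq_lintegral_ofReal hu.abs (.of_forall fun _ => abs_nonneg _)] at this
  have e : (2 ^ d : ENNReal) = ENNReal.ofReal (2 ^ d) := by
    rw [ENNReal.ofReal_pow (by norm_num)]; simp
  rw [e, ← ENNReal.ofReal_mul (by positivity)] at this
  refine (ENNReal.ofReal_le_ofReal_iff ?_).1 this
  exact mul_nonneg (by positivity) (integral_nonneg fun _ => abs_nonneg _)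

lemma lint_avg_le {d : ℕ} {ψ : EE d → EE d} {κ : ℝ} (h0 : 0 ≤ κ) (h1 : κ ≤ 1 / 2)
    (hlip : ∀ x y, ‖ψ x - ψ y‖ ≤ κ * ‖x - y‖) (hψ : Continuous ψ)
    {w : EE d → ENNReal} (hw : Measurable w) :
    ∫⁻ x, ∫⁻ t in Icc (0:ℝ) 1, w (x + t • ψ x) ≤ 2 ^ d * ∫⁻ x, w x := by
  rw [lintegral_lintegral_swap]
  · calc _ ≤ ∫⁻ t in Icc (0:ℝ) 1, 2 ^ d * ∫⁻ x, w x := by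
          refine setLIntegral_mono' measurableSet_Icc fun t ht => ?_
          exact lint_comp_le (antilip h0 h1 hlip ht) (by fun_prop) hw
      _ = _ := by simp
  · have : Measurable (Function.uncurry fun (x : EE d) (t : ℝ) => w (x + t • ψ x)) := by
      refine hw.comp (Continuous.measurable ?_)
      fun_prop
    exact this.aemeasurable

noncomputable def divg {d : ℕ} (ψ : EE d → EE d) (x : EE d) : ℝ :=
  ∑ i, lineDeriv ℝ (fun y => ψ y i) x (EuclideanSpace.single i 1)

lemma comp_lip {d : ℕ} {ψ : EE d → EE d} {κ : ℝ} (h0 : 0 ≤ κ)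
    (hlip : ∀ x y, ‖ψ x - ψ y‖ ≤ κ * ‖x - y‖) (i : Fin d) :
    LipschitzWith κ.toNNReal (fun y => ψ y i) := by
  refine LipschitzWith.of_dist_le_mul fun x y => ?_
  rw [dist_eq_norm, dist_eq_norm, Real.coe_toNNReal _ h0]
  exact (PiLp.norm_apply_le (ψ x - ψ y) i).trans (hlip x y)

lemma divg_meas {d : ℕ} {ψ : EE d → EE d} (hψ : Continuous ψ) : Measurable (divg ψ) := by
  unfold divg
  refine Finset.measurable_fun_sum _ fun i _ => ?_
  exact measurable_lineDeriv (by fun_prop)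

lemma divg_bound {d : ℕ} {ψ : EE d → EE d} {κ : ℝ} (h0 : 0 ≤ κ)
    (hlip : ∀ x y, ‖ψ x - ψ y‖ ≤ κ * ‖x - y‖) (x : EE d) : |divg ψ x| ≤ d * κ := by
  unfold divg
  calc _ ≤ ∑ i, |lineDeriv ℝ (fun y => ψ y i) x (EuclideanSpace.single i 1)| :=
        Finset.abs_sum_le_sum_abs _ _
    _ ≤ ∑ i : Fin d, κ := Finset.sum_le_sum fun i _ => by
        have := norm_lineDeriv_le_of_lipschitz ℝ (comp_lip h0 hlip i) (x₀ := x)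
          (v := EuclideanSpace.single i 1)
        simpa [Real.coe_toNNReal _ h0] using this
    _ = _ := by simp

lemma surj {d : ℕ} {ψ : EE d → EE d} {κ : ℝ} (h0 : 0 ≤ κ) (h1 : κ ≤ 1 / 2)
    (hlip : ∀ x y, ‖ψ x - ψ y‖ ≤ κ * ‖x - y‖) : Function.Surjective (fun x => x + ψ x) := by
  intro y
  have hc : ContractingWith (1/2) (fun x => y - ψ x) := by
    refine ⟨by rw [← NNReal.coe_lt_coe]; norm_num, LipschitzWith.of_dist_le_mul fun a b => ?_⟩
    rw [dist_eq_norm, dist_eq_norm]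
    calc _ = ‖ψ a - ψ b‖ := by rw [sub_sub_sub_cancel_left, norm_sub_rev]
      _ ≤ κ * ‖a - b‖ := hlip a b
      _ ≤ _ := by push_cast; gcongr
  refine ⟨hc.fixedPoint, ?_⟩
  have := hc.fixedPoint_isFixedPt
  rw [Function.IsFixedPt] at this
  exact (sub_eq_iff_eq_add.1 this).symm

lemma change_var (d : ℕ) : ∃ C : ℝ, 0 ≤ C ∧ ∀ (ψ : EE d → EE d) (κ : ℝ), 0 ≤ κ → κ ≤ 1 / 2 →
    (∀ x y, ‖ψ x - ψ y‖ ≤ κ * ‖x - y‖) → ∀ u : EE d → ℝ, Continuous u → Integrable u →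
    |(∫ x, u (x + ψ x)) - (∫ x, u x) + ∫ x, u (x + ψ x) * divg ψ x| ≤ C * κ ^ 2 * ∫ x, |u x| := by
  obtain ⟨C, hC, hdet⟩ := det_bound d
  refine ⟨C * 2 ^ d, by positivity, fun ψ κ h0 h1 hlip u huc hu => ?_⟩
  have hψl : LipschitzWith κ.toNNReal ψ := LipschitzWith.of_dist_le_mul fun x y => by
    rw [dist_eq_norm, dist_eq_norm, Real.coe_toNNReal _ h0]; exact hlip x y
  have hψ := hψl.continuous
  have hanti : AntilipschitzWith 2 (fun x => x + ψ x) := by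
    simpa using antilip h0 h1 hlip (t := 1) (by simp)
  have hPc : Continuous (fun x => x + ψ x) := by fun_prop
  have hPl : LipschitzWith (1 + κ.toNNReal) (fun x => x + ψ x) := LipschitzWith.id.add hψl
  set s := {x | DifferentiableAt ℝ ψ x} with hs
  have hsm : MeasurableSet s := measurableSet_of_differentiableAt ℝ ψ
  have hae : ∀ᵐ x, x ∈ s := hψl.ae_differentiableAt
  have hs0 : volume sᶜ = 0 := hae
  have him0 : volume ((fun x => x + ψ x) '' sᶜ) = 0 := null_image d hPl _ hs0
  have him : ((fun x => x + ψ x) '' s) =ᵐ[volume] univ := by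
    rw [ae_eq_univ]
    refine measure_mono_null ?_ him0
    intro y hy
    obtain ⟨x, rfl⟩ := surj h0 h1 hlip y
    refine ⟨x, fun hx => hy ⟨x, hx, rfl⟩, rfl⟩
  have hsu : s =ᵐ[volume] univ := by rw [ae_eq_univ]; exact hs0
  have hder : ∀ x ∈ s, HasFDerivWithinAt (fun x => x + ψ x) (1 + fderiv ℝ ψ x) s x := fun x hx =>
    ((hasFDerivAt_id x).add (DifferentiableAt.hasFDerivAt hx)).hasFDerivWithinAt
  have hinj : InjOn (fun x => x + ψ x) s := hanti.injective.injOn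
  have hI := integral_image_eq_integral_abs_det_fderiv_smul volume hsm hder hinj u
  have hInt := (integrableOn_image_iff_integrableOn_abs_det_fderiv_smul volume hsm hder hinj u).1
    hu.integrableOn
  rw [setIntegral_congr_set him, setIntegral_univ, setIntegral_congr_set hsu, setIntegral_univ] at hI
  rw [integrableOn_congr_set_ae hsu, integrableOn_univ] at hInt
  have huP := integrable_comp hanti hPc hu
  have hDint : Integrable (fun x => u (x + ψ x) * divg ψ x) :=
    huP.mul_bdd (c := d * κ) (divg_meas hψ).aestronglyMeasurable
      (.of_forall fun x => divg_bound h0 hlip x)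
  have hsub : Integrable (fun x => u (x + ψ x) - |(1 + fderiv ℝ ψ x).det| • u (x + ψ x)) :=
    huP.sub hInt
  rw [hI, ← integral_sub huP hInt, ← integral_add hsub hDint]
  have hbd : ∀ᵐ x, ‖u (x + ψ x) - |(1 + fderiv ℝ ψ x).det| • u (x + ψ x) + u (x + ψ x) * divg ψ x‖ ≤
      C * κ ^ 2 * |u (x + ψ x)| := by
    filter_upwards [hae] with x hx
    have hn : ‖fderiv ℝ ψ x‖ ≤ κ := by
      simpa [Real.coe_toNNReal _ h0] using norm_fderiv_le_of_lipschitz ℝ hψl (x₀ := x)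
    have hdiv : divg ψ x = ∑ i, (fderiv ℝ ψ x (EuclideanSpace.single i 1)) i := by
      unfold divg
      refine Finset.sum_congr rfl fun i _ => ?_
      have hx' : HasFDerivAt ψ (fderiv ℝ ψ x) x := DifferentiableAt.hasFDerivAt hx
      have h2 : HasFDerivAt (fun y => ψ y i)
          ((EuclideanSpace.proj i : EE d →L[ℝ] ℝ).comp (fderiv ℝ ψ x)) x :=
        (EuclideanSpace.proj i : EE d →L[ℝ] ℝ).hasFDerivAt.comp x hx'
      rw [(h2.hasLineDerivAt _).lineDeriv]
      rfl
    have h3 := hdet (fderiv ℝ ψ x) (hn.trans h1)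
    rw [← hdiv] at h3
    have e : u (x + ψ x) - |(1 + fderiv ℝ ψ x).det| • u (x + ψ x) + u (x + ψ x) * divg ψ x =
      -((|(1 + fderiv ℝ ψ x).det| - (1 + divg ψ x)) * u (x + ψ x)) := by
      rw [smul_eq_mul]; ring
    rw [e, norm_neg, Real.norm_eq_abs, abs_mul]
    gcongr
    exact h3.trans (by gcongr)
  calc _ ≤ ∫ x, C * κ ^ 2 * |u (x + ψ x)| := by
        have := norm_integral_le_of_norm_le (huP.abs.const_mul (C * κ ^ 2)) hbd
        exact this
    _ = C * κ ^ 2 * ∫ x, |u (x + ψ x)| := integral_const_mul _ _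
    _ ≤ C * κ ^ 2 * (2 ^ d * ∫ x, |u x|) := by
        gcongr
        exact integral_abs_comp_le hanti hPc huc hu
    _ = _ := by ring

lemma ibp0 {d : ℕ} {ψ : EE d → EE d} {κ : ℝ} (h0 : 0 ≤ κ)
    (hlip : ∀ x y, ‖ψ x - ψ y‖ ≤ κ * ‖x - y‖) (hψ : Continuous ψ) {v : EE d → ℝ}
    (hv : ContDiff ℝ 1 v) (hvs : HasCompactSupport v) :
    ∫ x, divg ψ x * v x = - ∫ x, fderiv ℝ v x (ψ x) := by
  obtain ⟨L, hL⟩ := ContDiff.lipschitzWith_of_hasCompactSupport (𝕂 := ℝ) hvs hv (by norm_num)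
  have hvc := hv.continuous
  have hvi : Integrable v := hvc.integrable_of_hasCompactSupport hvs
  have hfc : Continuous (fderiv ℝ v) := hv.continuous_fderiv (by norm_num)
  have e1 : ∀ x, fderiv ℝ v x (ψ x) =
      ∑ i, fderiv ℝ v x (EuclideanSpace.single i 1) * ψ x i := by
    intro x
    have : ψ x = ∑ i, (ψ x i) • (EuclideanSpace.single i (1:ℝ) : EE d) := by
      simpa using ((EuclideanSpace.basisFun (Fin d) ℝ).sum_repr (ψ x)).symm
    conv_lhs => rw [this]
    rw [map_sum]
    simp [mul_comm]
  simp_rw [e1, divg, Finset.sum_mul]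
  rw [integral_finsetSum, integral_finsetSum, ← Finset.sum_neg_distrib]
  · refine Finset.sum_congr rfl fun i _ => ?_
    rw [LipschitzWith.integral_lineDeriv_mul_eq (comp_lip h0 hlip i) hL hvs, ← integral_neg]
    congr 1
    funext x
    rw [(hv.differentiable (by norm_num)).differentiableAt.lineDeriv_eq_fderiv]
    simp
  · intro i _
    refine Continuous.integrable_of_hasCompactSupport (by fun_prop) ?_
    refine HasCompactSupport.mul_right ?_
    exact (hvs.fderiv ℝ).comp_left (g := fun A => A (EuclideanSpace.single i 1)) (by simp)
  · intro i _
    exact hvi.bdd_mul (measurable_lineDeriv (by fun_prop)).aestronglyMeasurable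
      (.of_forall fun x => norm_lineDeriv_le_of_lipschitz ℝ (comp_lip h0 hlip i))

open Filter Topology in
lemma ibp {d : ℕ} {ψ : EE d → EE d} {κ : ℝ} (h0 : 0 ≤ κ)
    (hlip : ∀ x y, ‖ψ x - ψ y‖ ≤ κ * ‖x - y‖) (hψ : Continuous ψ) (hb : ∀ x, ‖ψ x‖ ≤ 2 * κ)
    {f g : EE d → ℝ} {M : ℝ} (hf : ContDiff ℝ 1 f) (hg : ContDiff ℝ 1 g) (hM : ∀ x, |f x| ≤ M)
    (hgi : Integrable g) (hgi' : Integrable (fun x => fderiv ℝ g x))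
    (hfi : Integrable (fun x => fderiv ℝ f x (ψ x) * g x)) :
    ∫ x, fderiv ℝ f x (ψ x) * g x =
      - (∫ x, divg ψ x * (f x * g x)) - ∫ x, f x * fderiv ℝ g x (ψ x) := by
  have hM0 : 0 ≤ M := (abs_nonneg _).trans (hM 0)
  have hfc := hf.continuous
  have hgc := hg.continuous
  have hfc' : Continuous (fderiv ℝ f) := hf.continuous_fderiv (by norm_num)
  have hgc' : Continuous (fderiv ℝ g) := hg.continuous_fderiv (by norm_num)
  have hfgi : Integrable (fun x => f x * g x) :=
    hgi.bdd_mul hfc.aestronglyMeasurable (.of_forall hM)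
  have hgψ : Integrable (fun x => fderiv ℝ g x (ψ x)) := by
    refine (hgi'.norm.mul_const (2 * κ)).mono' (by fun_prop) (.of_forall fun x => ?_)
    exact (ContinuousLinearMap.le_opNorm _ _).trans (by gcongr; exact hb x)
  have hfgψ : Integrable (fun x => f x * fderiv ℝ g x (ψ x)) :=
    hgψ.bdd_mul hfc.aestronglyMeasurable (.of_forall hM)
  let χ : ContDiffBump (0 : EE d) := ⟨1, 2, by norm_num, by norm_num⟩
  have hχ : ContDiff ℝ 1 χ := χ.contDiff
  have hχc := hχ.continuous
  have hχc' : Continuous (fderiv ℝ χ) := hχ.continuous_fderiv (by norm_num)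
  obtain ⟨K, hK⟩ := (χ.hasCompactSupport.fderiv ℝ).exists_bound_of_continuous hχc'
  have hK0 : 0 ≤ K := (norm_nonneg _).trans (hK 0)
  set r : ℕ → ℝ := fun n => 1 / ((n : ℝ) + 1) with hr
  have hr0 : ∀ n, 0 < r n := fun n => by simp only [hr]; positivity
  have hr1 : ∀ n, r n ≤ 1 := fun n => by
    simp only [hr]
    rw [div_le_one (by positivity)]
    have : (0:ℝ) ≤ n := by positivity
    linarith
  have hrt : Tendsto r atTop (𝓝 0) := tendsto_one_div_add_atTop_nhds_zero_nat
  have hχn : ∀ n, ContDiff ℝ 1 (fun x : EE d => χ (r n • x)) := fun n =>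
    hχ.comp (contDiff_id.const_smul (r n))
  have hdχ : ∀ n (x w : EE d), fderiv ℝ (fun x : EE d => χ (r n • x)) x w =
      r n * fderiv ℝ χ (r n • x) w := by
    intro n x w
    have h1 : HasFDerivAt χ (fderiv ℝ χ (r n • x)) (r n • x) :=
      ((hχ.differentiable (by norm_num)) _).hasFDerivAt
    have h2 : HasFDerivAt (fun x : EE d => r n • x) (r n • ContinuousLinearMap.id ℝ (EE d)) x :=
      (hasFDerivAt_id x).const_smul (r n)
    have h3 : HasFDerivAt (fun x : EE d => χ (r n • x)) ((fderiv ℝ χ (r n • x)).comp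
      (r n • ContinuousLinearMap.id ℝ (EE d))) x := h1.comp x h2
    rw [h3.fderiv]
    simp
  have key : ∀ n, ∫ x, divg ψ x * (χ (r n • x) * (f x * g x)) =
      - ∫ x, ((r n * fderiv ℝ χ (r n • x) (ψ x)) * (f x * g x) +
        χ (r n • x) * (fderiv ℝ f x (ψ x) * g x + f x * fderiv ℝ g x (ψ x))) := by
    intro n
    rw [ibp0 h0 hlip hψ ((hχn n).mul (hf.mul hg))]
    · congr 2
      funext x
      have a1 := ((hχn n).differentiable (by norm_num) x)
      have a2 := (hf.differentiable (by norm_num) x)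
      have a3 := (hg.differentiable (by norm_num) x)
      rw [fderiv_fun_mul a1 (a2.fun_mul a3), fderiv_fun_mul a2 a3]
      simp only [ContinuousLinearMap.add_apply, ContinuousLinearMap.smul_apply, smul_eq_mul, hdχ]
      ring
    · refine HasCompactSupport.mul_right ?_
      exact χ.hasCompactSupport.comp_homeomorph (Homeomorph.smulOfNeZero (r n) (hr0 n).ne')
  have hsm : ∀ x : EE d, Tendsto (fun n => r n • x) atTop (𝓝 0) := fun x => by
    simpa using hrt.smul_const x
  have hχ0 : χ 0 = 1 := χ.one_of_mem_closedBall (Metric.mem_closedBall_self χ.rIn_pos.le)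
  have hχt : ∀ x : EE d, Tendsto (fun n => χ (r n • x)) atTop (𝓝 1) := fun x => by
    have := (hχc.tendsto 0).comp (hsm x)
    rw [hχ0] at this
    exact this
  have lim1 : Tendsto (fun n => ∫ x, divg ψ x * (χ (r n • x) * (f x * g x))) atTop
      (𝓝 (∫ x, divg ψ x * (f x * g x))) := by
    refine tendsto_integral_of_dominated_convergence (fun x => d * κ * |f x * g x|) ?_
      (hfgi.abs.const_mul _) ?_ ?_
    · intro n
      refine (divg_meas hψ).aestronglyMeasurable.mul (Continuous.aestronglyMeasurable ?_)
      have := (hχn n).continuous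
      fun_prop
    · intro n
      refine .of_forall fun x => ?_
      rw [Real.norm_eq_abs, abs_mul, abs_mul (χ _)]
      gcongr
      · exact divg_bound h0 hlip x
      · rw [abs_of_nonneg χ.nonneg]
        exact mul_le_of_le_one_left (abs_nonneg _) χ.le_one
    · refine .of_forall fun x => ?_
      have := ((hχt x).mul_const (f x * g x)).const_mul (divg ψ x)
      rwa [one_mul] at this
  have lim2 : Tendsto (fun n => ∫ x, ((r n * fderiv ℝ χ (r n • x) (ψ x)) * (f x * g x) +
        χ (r n • x) * (fderiv ℝ f x (ψ x) * g x + f x * fderiv ℝ g x (ψ x)))) atTop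
      (𝓝 (∫ x, (fderiv ℝ f x (ψ x) * g x + f x * fderiv ℝ g x (ψ x)))) := by
    refine tendsto_integral_of_dominated_convergence
      (fun x => K * (2 * κ) * |f x * g x| +
        |fderiv ℝ f x (ψ x) * g x + f x * fderiv ℝ g x (ψ x)|) ?_
      ((hfgi.abs.const_mul _).add (hfi.add hfgψ).abs) ?_ ?_
    · intro n
      refine Continuous.aestronglyMeasurable ?_
      have := (hχn n).continuous
      fun_prop
    · intro n
      refine .of_forall fun x => ?_
      rw [Real.norm_eq_abs]
      refine (abs_add_le _ _).trans ?_
      rw [abs_mul, abs_mul (χ _), abs_mul (r n)]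
      refine add_le_add (mul_le_mul_of_nonneg_right ?_ (abs_nonneg _)) ?_
      · rw [abs_of_pos (hr0 n)]
        refine (mul_le_of_le_one_left (abs_nonneg _) (hr1 n)).trans ?_
        refine (ContinuousLinearMap.le_opNorm (fderiv ℝ χ (r n • x)) (ψ x)).trans ?_
        gcongr
        · exact hK _
        · exact hb x
      · rw [abs_of_nonneg χ.nonneg]
        exact mul_le_of_le_one_left (abs_nonneg _) χ.le_one
    · refine .of_forall fun x => ?_
      have t1 : Tendsto (fun n => fderiv ℝ χ (r n • x) (ψ x)) atTop (𝓝 (fderiv ℝ χ 0 (ψ x))) := by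
        have hc : Continuous (fun y => fderiv ℝ χ y (ψ x)) := by fun_prop
        exact (hc.tendsto 0).comp (hsm x)
      have := ((hrt.mul t1).mul_const (f x * g x)).add ((hχt x).mul_const
        (fderiv ℝ f x (ψ x) * g x + f x * fderiv ℝ g x (ψ x)))
      rwa [zero_mul, zero_mul, one_mul, zero_add] at this
  have lim3 := lim2.neg
  simp_rw [← key] at lim3
  have := tendsto_nhds_unique lim1 lim3
  rw [integral_add hfi hfgψ] at this
  linarith

lemma ftc_bound {h h' : ℝ → ℝ} (hd : ∀ t, HasDerivAt h (h' t) t) (hc : Continuous h') {t : ℝ}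
    (ht : t ∈ Icc (0:ℝ) 1) : ‖h t - h 0‖ₑ ≤ ∫⁻ s in Icc (0:ℝ) 1, ‖h' s‖ₑ := by
  rw [← intervalIntegral.integral_eq_sub_of_hasDerivAt (fun x _ => hd x)
    (hc.intervalIntegrable _ _), intervalIntegral.integral_of_le ht.1]
  refine (enorm_integral_le_lintegral_enorm _).trans ?_
  exact lintegral_mono_set fun s hs => ⟨hs.1.le, hs.2.trans ht.2⟩

lemma wpt {d : ℕ} {V : Type*} [NormedAddCommGroup V] {ψ : EE d → EE d} {κ : ℝ} (h0 : 0 ≤ κ)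
    (h1 : κ ≤ 1 / 2)
    (hlip : ∀ x y, ‖ψ x - ψ y‖ ≤ κ * ‖x - y‖) (hz : ψ 0 = 0) (hb : ∀ x, ‖ψ x‖ ≤ 2 * κ)
    {t : ℝ} (ht : t ∈ Icc (0:ℝ) 1) {q : ℝ} (hq : 0 ≤ q) (G : EE d → V) (x : EE d) :
    ‖ψ x‖ₑ ^ q * ‖G (x + t • ψ x)‖ₑ ≤ ENNReal.ofReal ((4 * κ) ^ q) *
      ENNReal.ofReal (‖G (x + t • ψ x)‖ * (min ‖x + t • ψ x‖ 1) ^ q) := by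
  have hm : 0 ≤ min ‖x + t • ψ x‖ 1 := by positivity
  rw [← ENNReal.ofReal_mul (by positivity), ← ofReal_norm, ← ofReal_norm,
    ENNReal.ofReal_rpow_of_nonneg (norm_nonneg _) hq, ← ENNReal.ofReal_mul (by positivity)]
  refine ENNReal.ofReal_le_ofReal ?_
  calc _ ≤ (4 * κ * min ‖x + t • ψ x‖ 1) ^ q * ‖G (x + t • ψ x)‖ := by
        gcongr
        exact psi_le h0 h1 hlip hz hb ht x
    _ = _ := by rw [Real.mul_rpow (by positivity) hm]; ring

lemma wavg {d : ℕ} {V : Type*} [NormedAddCommGroup V] {ψ : EE d → EE d} {κ : ℝ} (h0 : 0 ≤ κ)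
    (h1 : κ ≤ 1 / 2)
    (hlip : ∀ x y, ‖ψ x - ψ y‖ ≤ κ * ‖x - y‖) (hψ : Continuous ψ) (hz : ψ 0 = 0)
    (hb : ∀ x, ‖ψ x‖ ≤ 2 * κ)
    {q : ℝ} (hq : 0 ≤ q) {G : EE d → V} (hG : Continuous G) :
    ∫⁻ x, ‖ψ x‖ₑ ^ q * ∫⁻ t in Icc (0:ℝ) 1, ‖G (x + t • ψ x)‖ₑ ≤ ENNReal.ofReal ((4 * κ) ^ q) *
      (2 ^ d * ∫⁻ x, ENNReal.ofReal (‖G x‖ * (min ‖x‖ 1) ^ q)) := by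
  have hW : Continuous (fun x : EE d => ENNReal.ofReal (‖G x‖ * (min ‖x‖ 1) ^ q)) := by
    have : Continuous (fun x : EE d => (min ‖x‖ 1) ^ q) :=
      (Continuous.min continuous_norm continuous_const).rpow_const (fun _ => Or.inr hq)
    exact ENNReal.continuous_ofReal.comp (hG.norm.mul this)
  refine le_trans ?_ (mul_le_mul_right (lint_avg_le h0 h1 hlip hψ hW.measurable) _)
  rw [← lintegral_const_mul' _ _ (by simp)]
  refine lintegral_mono fun x => ?_
  rw [← lintegral_const_mul' _ _ (by simp [hq]), ← lintegral_const_mul' _ _ (by simp)]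
  refine setLIntegral_mono' measurableSet_Icc fun t ht => ?_
  exact wpt h0 h1 hlip hz hb ht hq G x

lemma wint {d : ℕ} {V : Type*} [NormedAddCommGroup V]  {q : ℝ} (hq : 0 ≤ q)
    {G : EE d → V} (hG : Continuous G) (hi : Integrable G) :
    Integrable (fun x => ‖G x‖ * (min ‖x‖ 1) ^ q) := by
  have : Continuous (fun x : EE d => (min ‖x‖ 1) ^ q) :=
      (Continuous.min continuous_norm continuous_const).rpow_const (fun _ => Or.inr hq)
  refine hi.norm.mul_bdd (c := 1) this.aestronglyMeasurable (.of_forall fun x => ?_)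
  have hm : 0 ≤ min ‖x‖ 1 := by positivity
  rw [Real.norm_eq_abs, abs_of_nonneg (by positivity)]
  exact Real.rpow_le_one hm (min_le_right _ _) hq

lemma hasDeriv_line {d : ℕ} {g : EE d → ℝ} (hg : Differentiable ℝ g) (x v : EE d) (t : ℝ) :
    HasDerivAt (fun t : ℝ => g (x + t • v)) (fderiv ℝ g (x + t • v) v) t := by
  have h3 : HasDerivAt (fun t : ℝ => x + t • v) v t := by
    simpa using ((hasDerivAt_id t).smul_const v).const_add x
  exact (hg (x + t • v)).hasFDerivAt.comp_hasDerivAt t h3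

lemma hasDeriv_line2 {d : ℕ} {g : EE d → ℝ} (hg : Differentiable ℝ (fderiv ℝ g)) (x v : EE d)
    (t : ℝ) :
    HasDerivAt (fun t : ℝ => fderiv ℝ g (x + t • v) v)
      (fderiv ℝ (fderiv ℝ g) (x + t • v) v v) t := by
  have h3 : HasDerivAt (fun t : ℝ => x + t • v) v t := by
    simpa using ((hasDerivAt_id t).smul_const v).const_add x
  have h4 := (hg (x + t • v)).hasFDerivAt.comp_hasDerivAt t h3
  exact (ContinuousLinearMap.apply ℝ ℝ v).hasFDerivAt.comp_hasDerivAt t h4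

lemma first_pt {d : ℕ} {g : EE d → ℝ} (hg : ContDiff ℝ 1 g) (x v : EE d) :
    ‖g (x + v) - g x‖ₑ ≤ ‖v‖ₑ * ∫⁻ t in Icc (0:ℝ) 1, ‖fderiv ℝ g (x + t • v)‖ₑ := by
  have hc : Continuous (fderiv ℝ g) := hg.continuous_fderiv (by norm_num)
  have := ftc_bound (hasDeriv_line (hg.differentiable (by norm_num)) x v) (by fun_prop)
    (t := 1) (by simp)
  simp only [one_smul, zero_smul, add_zero] at this
  refine this.trans ?_
  rw [← lintegral_const_mul' _ _ (by simp)]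
  refine lintegral_mono fun t => ?_
  rw [mul_comm]
  exact ContinuousLinearMap.le_opENorm _ _

lemma second_pt {d : ℕ} {g : EE d → ℝ} (hg : ContDiff ℝ 2 g) (x v : EE d) :
    ‖g (x + v) - g x - fderiv ℝ g x v‖ₑ ≤
      ‖v‖ₑ ^ (2:ℝ) * ∫⁻ t in Icc (0:ℝ) 1, ‖iteratedFDeriv ℝ 2 g (x + t • v)‖ₑ := by
  have hg' : ContDiff ℝ 1 (fderiv ℝ g) := hg.fderiv_right (by norm_num)
  have hc : Continuous (fderiv ℝ g) := hg'.continuous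
  have hc2 : Continuous (fderiv ℝ (fderiv ℝ g)) := hg'.continuous_fderiv (by norm_num)
  set B := ‖v‖ₑ ^ (2:ℝ) * ∫⁻ t in Icc (0:ℝ) 1, ‖iteratedFDeriv ℝ 2 g (x + t • v)‖ₑ with hB
  have s1 : ∀ t ∈ Icc (0:ℝ) 1, ‖fderiv ℝ g (x + t • v) v - fderiv ℝ g x v‖ₑ ≤ B := by
    intro t ht
    have := ftc_bound (hasDeriv_line2 (hg'.differentiable (by norm_num)) x v) (by fun_prop) ht
    simp only [zero_smul, add_zero] at this
    refine this.trans ?_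
    rw [hB, ← lintegral_const_mul' _ _ (by simp)]
    refine lintegral_mono fun t => ?_
    have e : ‖iteratedFDeriv ℝ 2 g (x + t • v)‖ₑ = ‖fderiv ℝ (fderiv ℝ g) (x + t • v)‖ₑ := by
      rw [← ofReal_norm, ← ofReal_norm]
      congr 1
      rw [show (2:ℕ) = 1 + 1 from rfl, ← norm_iteratedFDeriv_fderiv, ← zero_add 1,
        ← norm_iteratedFDeriv_fderiv, norm_iteratedFDeriv_zero]
    rw [e]
    refine (ContinuousLinearMap.le_opENorm _ _).trans ?_
    rw [show (2:ℝ) = ((2:ℕ):ℝ) by norm_num, ENNReal.rpow_natCast, pow_two, mul_assoc, mul_comm]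
    refine mul_le_mul_right ?_ _
    rw [mul_comm]
    exact ContinuousLinearMap.le_opENorm _ _
  have hd : ∀ t, HasDerivAt (fun t : ℝ => g (x + t • v) - t * fderiv ℝ g x v)
      (fderiv ℝ g (x + t • v) v - 1 * fderiv ℝ g x v) t := fun t =>
    (hasDeriv_line (hg.differentiable (by norm_num)) x v t).sub
      ((hasDerivAt_id t).mul_const _)
  have := ftc_bound hd (by fun_prop) (t := 1) (by simp)
  simp only [one_smul, zero_smul, add_zero, one_mul, zero_mul, sub_zero] at this
  rw [show g (x + v) - g x - fderiv ℝ g x v = g (x + v) - fderiv ℝ g x v - g x by ring]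
  refine this.trans ((setLIntegral_mono' measurableSet_Icc s1).trans ?_)
  simp

lemma to_real_of_lint {d : ℕ} {R W : EE d → ℝ} {c : ℝ} (hc : 0 ≤ c) (hR : Integrable R)
    (hW : Integrable W) (hW0 : ∀ x, 0 ≤ W x)
    (h : ∫⁻ x, ‖R x‖ₑ ≤ ENNReal.ofReal c * ∫⁻ x, ENNReal.ofReal (W x)) :
    ∫ x, |R x| ≤ c * ∫ x, W x := by
  have e : ∫⁻ x, ‖R x‖ₑ = ENNReal.ofReal (∫ x, |R x|) := 
    (ofReal_integral_norm_eq_lintegral_enorm hR).symm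
  rw [e, ← ofReal_integral_eq_lintegral_ofReal hW (.of_forall hW0), ← ENNReal.ofReal_mul hc] at h
  exact (ENNReal.ofReal_le_ofReal_iff (mul_nonneg hc (integral_nonneg hW0))).1 h

lemma E1 {d : ℕ} {ψ : EE d → EE d} {κ : ℝ} (h0 : 0 ≤ κ) (h1 : κ ≤ 1 / 2)
    (hlip : ∀ x y, ‖ψ x - ψ y‖ ≤ κ * ‖x - y‖) (hψ : Continuous ψ) (hz : ψ 0 = 0)
    (hb : ∀ x, ‖ψ x‖ ≤ 2 * κ) {g : EE d → ℝ} (hg : ContDiff ℝ 1 g) (hgi : Integrable g)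
    (hgi' : Integrable (fun x => fderiv ℝ g x)) :
    ∫ x, |g (x + ψ x) - g x| ≤ 4 * 2 ^ d * κ * ∫ x, ‖fderiv ℝ g x‖ * min ‖x‖ 1 := by
  have hc : Continuous (fderiv ℝ g) := hg.continuous_fderiv (by norm_num)
  have hanti : AntilipschitzWith 2 (fun x => x + ψ x) := by
    simpa using antilip h0 h1 hlip (t := 1) (by simp)
  have hR : Integrable (fun x => g (x + ψ x) - g x) :=
    (integrable_comp hanti (by fun_prop) hgi).sub hgi
  have hW := wint (q := 1) (by norm_num) hc hgi'
  have hl := wavg (q := 1) h0 h1 hlip hψ hz hb (by norm_num) hc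
  simp only [Real.rpow_one, ENNReal.rpow_one] at hW hl
  refine to_real_of_lint (by positivity) hR hW (fun x => by positivity) ?_
  refine (lintegral_mono fun x => first_pt hg x (ψ x)).trans (hl.trans (le_of_eq ?_))
  rw [show 4 * 2 ^ d * κ = (4 * κ) * 2 ^ d by ring, ENNReal.ofReal_mul (by positivity) (p := 4 * κ),
    ENNReal.ofReal_pow (by norm_num), ENNReal.ofReal_ofNat, mul_assoc]

lemma interp (p r a b : ENNReal) {θ : ℝ} (h0 : 0 ≤ θ) (h1 : θ ≤ 1)
    (ha : r ≤ p * a) (hb : r ≤ p ^ (2:ℝ) * b) :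
    r ≤ (p ^ (1 + θ) * b) ^ θ * (p ^ (1 + θ) * a) ^ (1 - θ) := by
  have h2 : 0 ≤ 1 - θ := by linarith
  calc r = r ^ θ * r ^ (1 - θ) := by
        rw [← ENNReal.rpow_add_of_nonneg _ _ h0 h2]; simp
    _ ≤ (p ^ (2:ℝ) * b) ^ θ * (p * a) ^ (1 - θ) := by gcongr
    _ = _ := by
        rw [ENNReal.mul_rpow_of_nonneg _ _ h0, ENNReal.mul_rpow_of_nonneg _ _ h2,
          ENNReal.mul_rpow_of_nonneg _ _ h0, ENNReal.mul_rpow_of_nonneg _ _ h2,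
          mul_mul_mul_comm, mul_mul_mul_comm (_ ^ θ) (b ^ θ)]
        congr 1
        rw [← ENNReal.rpow_mul, ← ENNReal.rpow_mul, ← ENNReal.rpow_mul,
          ← ENNReal.rpow_add_of_nonneg _ _ (by positivity) h2,
          ← ENNReal.rpow_add_of_nonneg _ _ (by positivity) (by positivity)]
        congr 1
        ring

lemma E2 {d : ℕ} {ψ : EE d → EE d} {κ : ℝ} (h0 : 0 ≤ κ) (h1 : κ ≤ 1 / 2)
    (hlip : ∀ x y, ‖ψ x - ψ y‖ ≤ κ * ‖x - y‖) (hψ : Continuous ψ) (hz : ψ 0 = 0)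
    (hb : ∀ x, ‖ψ x‖ ≤ 2 * κ) {θ : ℝ} (hθ0 : 0 ≤ θ) (hθ1 : θ ≤ 1)
    {g : EE d → ℝ} (hg : ContDiff ℝ 2 g) (hgi : Integrable g)
    (hgi' : Integrable (fun x => fderiv ℝ g x))
    (hgi2 : Integrable (fun x => iteratedFDeriv ℝ 2 g x)) :
    ∫ x, |g (x + ψ x) - g x - fderiv ℝ g x (ψ x)| ≤ 16 * (1 + 2 ^ d) * κ ^ (1 + θ) *
      ((∫ x, ‖iteratedFDeriv ℝ 2 g x‖ * (min ‖x‖ 1) ^ (1 + θ)) ^ θ *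
                  (∫ x, ‖fderiv ℝ g x‖ * (min ‖x‖ 1) ^ (1 + θ)) ^ (1 - θ)) := by
  have h2 : 0 ≤ 1 - θ := by linarith
  have hq : 0 ≤ 1 + θ := by linarith
  have hc : Continuous (fderiv ℝ g) := hg.continuous_fderiv (by norm_num)
  have hc2 : Continuous (iteratedFDeriv ℝ 2 g) := hg.continuous_iteratedFDeriv (by norm_num)
  have hanti : AntilipschitzWith 2 (fun x => x + ψ x) := by
    simpa using antilip h0 h1 hlip (t := 1) (by simp)
  have hgψ : Integrable (fun x => fderiv ℝ g x (ψ x)) := by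
    refine (hgi'.norm.mul_const (2 * κ)).mono' (by fun_prop) (.of_forall fun x => ?_)
    exact (ContinuousLinearMap.le_opNorm _ _).trans (by gcongr; exact hb x)
  have hR : Integrable (fun x => g (x + ψ x) - g x - fderiv ℝ g x (ψ x)) :=
    ((integrable_comp hanti (by fun_prop) hgi).sub hgi).sub hgψ
  have hW1 := wint hq hc hgi'
  have hW2 := wint hq hc2 hgi2
  have hl1 := wavg h0 h1 hlip hψ hz hb hq hc
  have hl2 := wavg h0 h1 hlip hψ hz hb hq hc2
  set b : EE d → ENNReal := fun x => ∫⁻ t in Icc (0:ℝ) 1, ‖iteratedFDeriv ℝ 2 g (x + t • ψ x)‖ₑ with hbdef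
  set a : EE d → ENNReal := fun x => ‖fderiv ℝ g x‖ₑ +
    ∫⁻ t in Icc (0:ℝ) 1, ‖fderiv ℝ g (x + t • ψ x)‖ₑ with hadef
  set I1 := ∫⁻ x, ENNReal.ofReal (‖fderiv ℝ g x‖ * (min ‖x‖ 1) ^ (1 + θ)) with hI1
  set I2 := ∫⁻ x, ENNReal.ofReal (‖iteratedFDeriv ℝ 2 g x‖ * (min ‖x‖ 1) ^ (1 + θ)) with hI2
  have hpt : ∀ x, ‖g (x + ψ x) - g x - fderiv ℝ g x (ψ x)‖ₑ ≤
      (‖ψ x‖ₑ ^ (1 + θ) * b x) ^ θ * (‖ψ x‖ₑ ^ (1 + θ) * a x) ^ (1 - θ) := by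
    intro x
    refine interp _ _ _ _ hθ0 hθ1 ?_ (second_pt hg x (ψ x))
    refine (enorm_sub_le).trans ?_
    rw [hadef, mul_add, add_comm]
    refine add_le_add ?_ (first_pt (hg.of_le (by norm_num)) x (ψ x))
    rw [mul_comm]
    exact ContinuousLinearMap.le_opENorm _ _
  have hψm : Measurable (fun x => ‖ψ x‖ₑ ^ (1 + θ)) := hψ.enorm.measurable.pow_const _
  have hbm : Measurable b := by
    have : Measurable (fun p : EE d × ℝ => ‖iteratedFDeriv ℝ 2 g (p.1 + p.2 • ψ p.1)‖ₑ) := by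
      refine Continuous.measurable (Continuous.enorm ?_)
      fun_prop
    exact this.lintegral_prod_right'
  have ham : Measurable a := by
    have : Measurable (fun p : EE d × ℝ => ‖fderiv ℝ g (p.1 + p.2 • ψ p.1)‖ₑ) := by
      refine Continuous.measurable (Continuous.enorm ?_)
      fun_prop
    exact hc.enorm.measurable.add this.lintegral_prod_right'
  have hla : ∫⁻ x, ‖ψ x‖ₑ ^ (1 + θ) * a x ≤ ENNReal.ofReal ((4 * κ) ^ (1 + θ)) * ((1 + 2 ^ d) * I1) := by
    simp only [hadef, mul_add]
    have hm : Measurable (fun x => ‖ψ x‖ₑ ^ (1 + θ) * ‖fderiv ℝ g x‖ₑ) :=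
      hψm.mul hc.enorm.measurable
    rw [lintegral_add_left hm, add_mul, mul_add]
    refine add_le_add ?_ hl1
    rw [one_mul, hI1, ← lintegral_const_mul' _ _ (by simp)]
    refine lintegral_mono fun x => ?_
    simpa using wpt h0 h1 hlip hz hb (t := 0) (by simp) hq (fderiv ℝ g) x
  have hlb : ∫⁻ x, ‖ψ x‖ₑ ^ (1 + θ) * b x ≤ ENNReal.ofReal ((4 * κ) ^ (1 + θ)) * ((1 + 2 ^ d) * I2) := by
    refine hl2.trans ?_
    gcongr
    exact le_add_self
  have hK : ENNReal.ofReal ((4 * κ) ^ (1 + θ)) * (1 + 2 ^ d) =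
      ENNReal.ofReal ((4 * κ) ^ (1 + θ) * (1 + 2 ^ d)) := by
    rw [ENNReal.ofReal_mul (by positivity), ENNReal.ofReal_add (by norm_num) (by positivity),
      ENNReal.ofReal_pow (by norm_num)]
    simp
  set K := (4 * κ) ^ (1 + θ) * (1 + 2 ^ d) with hKdef
  have hK0 : 0 ≤ K := by positivity
  rw [← mul_assoc, hK] at hla hlb
  have hJ1 : I1 = ENNReal.ofReal (∫ x, ‖fderiv ℝ g x‖ * (min ‖x‖ 1) ^ (1 + θ)) :=
    (ofReal_integral_eq_lintegral_ofReal hW1 (.of_forall fun x => by positivity)).symm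
  have hJ2 : I2 = ENNReal.ofReal (∫ x, ‖iteratedFDeriv ℝ 2 g x‖ * (min ‖x‖ 1) ^ (1 + θ)) :=
    (ofReal_integral_eq_lintegral_ofReal hW2 (.of_forall fun x => by positivity)).symm
  set J1 := ∫ x, ‖fderiv ℝ g x‖ * (min ‖x‖ 1) ^ (1 + θ)
  set J2 := ∫ x, ‖iteratedFDeriv ℝ 2 g x‖ * (min ‖x‖ 1) ^ (1 + θ)
  have hJ10 : 0 ≤ J1 := integral_nonneg fun x => by positivity
  have hJ20 : 0 ≤ J2 := integral_nonneg fun x => by positivity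
  have hfin : ENNReal.ofReal (∫ x, |g (x + ψ x) - g x - fderiv ℝ g x (ψ x)|) ≤
      ENNReal.ofReal ((K * J2) ^ θ * (K * J1) ^ (1 - θ)) := by
    have e : ENNReal.ofReal (∫ x, |g (x + ψ x) - g x - fderiv ℝ g x (ψ x)|) =
      ∫⁻ x, ‖g (x + ψ x) - g x - fderiv ℝ g x (ψ x)‖ₑ :=
      (ofReal_integral_norm_eq_lintegral_enorm hR)
    rw [e, ENNReal.ofReal_mul (by positivity), ← ENNReal.ofReal_rpow_of_nonneg (by positivity) hθ0,
      ← ENNReal.ofReal_rpow_of_nonneg (by positivity) h2, ENNReal.ofReal_mul hK0,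
      ENNReal.ofReal_mul hK0, ← hJ1, ← hJ2]
    refine (lintegral_mono hpt).trans ?_
    refine (ENNReal.lintegral_mul_norm_pow_le (hψm.mul hbm).aemeasurable
      (hψm.mul ham).aemeasurable hθ0 h2 (by ring)).trans ?_
    gcongr
    · exact hlb
    · exact hla
  refine ((ENNReal.ofReal_le_ofReal_iff (by positivity)).1 hfin).trans ?_
  rw [Real.mul_rpow hK0 hJ20, Real.mul_rpow hK0 hJ10, mul_mul_mul_comm,
    ← Real.rpow_add_of_nonneg hK0 hθ0 h2]
  have : θ + (1 - θ) = 1 := by ring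
  rw [this, Real.rpow_one, hKdef, Real.mul_rpow (by norm_num) h0]
  have h16 : (4:ℝ) ^ (1 + θ) ≤ 16 := by
    calc (4:ℝ) ^ (1 + θ) ≤ 4 ^ (2:ℝ) := Real.rpow_le_rpow_of_exponent_le (by norm_num) (by linarith)
      _ = 16 := by norm_num
  refine mul_le_mul_of_nonneg_right ?_ (by positivity)
  calc _ ≤ 16 * κ ^ (1 + θ) * (1 + 2 ^ d) := by gcongr
    _ = _ := by ring

set_option maxHeartbeats 1000000 in
lemma tot_aux {C1 D p k M H G N S : ℝ} (hC1 : 0 ≤ C1) (hD : 0 ≤ D) (hp : 0 ≤ p) (hk : 0 ≤ k)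
    (hM : 0 ≤ M) (hH : 0 ≤ H) (hG : 0 ≤ G) (hN : 0 ≤ N) (hS : 0 ≤ S) :
    C1 * k * (M * G) + ((H * k + D * k * M) * (4 * p * N) +
      M * (16 * (1 + p) * k * S) + D * k * H * G) ≤
      (1 + C1 + D + 4 * p + 4 * D * p + 16 * (1 + p)) * k * (M + H) * (G + N + S) := by
  rw [← sub_nonneg]
  ring_nf
  positivity

set_option maxHeartbeats 1000000 in
/-- Estimate (2.7) of the paper: bound on `⟨𝒟^φ₁ f, g⟩` where
`𝒟^φ₁ f(x) = f(x+φ(x)) − f(x+φ(0)) − (φ(x)−φ(0))·∇f(x)`, with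
`‖f‖_{C^θ}` encoded by a sup bound `M` and a θ-Hölder bound `H`. -/
theorem stmt10 (d : ℕ) (θ : ℝ) (hθ : θ ∈ Set.Icc (0 : ℝ) 1) :
    ∃ C > 0, ∀ (φ : EuclideanSpace ℝ (Fin d) → EuclideanSpace ℝ (Fin d)) (κ : ℝ),
      0 ≤ κ → κ ≤ 1 / 2 →
      (∀ x, ‖φ x‖ ≤ κ) →
      (∀ x y, ‖φ x - φ y‖ ≤ κ * ‖x - y‖) →
      ∀ (f : EuclideanSpace ℝ (Fin d) → ℝ) (M H : ℝ), ContDiff ℝ 1 f →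
        0 ≤ M → 0 ≤ H →
        (∀ x, |f x| ≤ M) →
        (∀ x y, |f x - f y| ≤ H * ‖x - y‖ ^ θ) →
        ∀ (g : EuclideanSpace ℝ (Fin d) → ℝ), ContDiff ℝ 2 g →
          Integrable g → Integrable (fun x => fderiv ℝ g x) →
          Integrable (fun x => iteratedFDeriv ℝ 2 g x) →
          |∫ x, (f (x + φ x) - f (x + φ 0) - fderiv ℝ f x (φ x - φ 0)) * g x| ≤
            C * κ ^ (1 + θ) * (M + H) *
              ((∫ x, |g x|) + (∫ x, ‖fderiv ℝ g x‖ * min ‖x‖ 1) +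
                (∫ x, ‖iteratedFDeriv ℝ 2 g x‖ * (min ‖x‖ 1) ^ (1 + θ)) ^ θ *
                  (∫ x, ‖fderiv ℝ g x‖ * (min ‖x‖ 1) ^ (1 + θ)) ^ (1 - θ)) := by
  obtain ⟨hθ0, hθ1⟩ := hθ
  obtain ⟨C1, hC1, hcv⟩ := change_var d
  refine ⟨1 + C1 + d + 4 * 2 ^ d + 4 * d * 2 ^ d + 16 * (1 + 2 ^ d), by positivity, ?_⟩
  intro φ κ h0 h1 hφ hφl f M H hf hM0 hH0 hM hH g hg hgi hgi' hgi2
  have hG0 : 0 ≤ ∫ x, |g x| := integral_nonneg fun x => abs_nonneg _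
  have hN0 : 0 ≤ ∫ x, ‖fderiv ℝ g x‖ * min ‖x‖ 1 := integral_nonneg fun x => by positivity
  have hS0 : 0 ≤ (∫ x, ‖iteratedFDeriv ℝ 2 g x‖ * (min ‖x‖ 1) ^ (1 + θ)) ^ θ *
      (∫ x, ‖fderiv ℝ g x‖ * (min ‖x‖ 1) ^ (1 + θ)) ^ (1 - θ) :=
    mul_nonneg (Real.rpow_nonneg (integral_nonneg fun x => by positivity) _)
      (Real.rpow_nonneg (integral_nonneg fun x => by positivity) _)
  have hψl : ∀ x y, ‖(φ x - φ 0) - (φ y - φ 0)‖ ≤ κ * ‖x - y‖ := fun x y => by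
    rw [sub_sub_sub_cancel_right]; exact hφl x y
  have hψ : Continuous (fun x => φ x - φ 0) := by
    have : LipschitzWith κ.toNNReal φ := LipschitzWith.of_dist_le_mul fun x y => by
      rw [dist_eq_norm, dist_eq_norm, Real.coe_toNNReal _ h0]; exact hφl x y
    exact this.continuous.sub continuous_const
  have hb : ∀ x, ‖φ x - φ 0‖ ≤ 2 * κ := fun x => by
    have := norm_sub_le (φ x) (φ 0); linarith [hφ x, hφ 0]
  have hE1 := E1 h0 h1 hψl hψ (by simp) hb (hg.of_le (by norm_num)) hgi hgi'
  have hE2 := E2 h0 h1 hψl hψ (by simp) hb hθ0 hθ1 hg hgi hgi' hgi2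
  set G := ∫ x, |g x| with hGdef
  set N := ∫ x, ‖fderiv ℝ g x‖ * min ‖x‖ 1 with hNdef
  set S := (∫ x, ‖iteratedFDeriv ℝ 2 g x‖ * (min ‖x‖ 1) ^ (1 + θ)) ^ θ *
      (∫ x, ‖fderiv ℝ g x‖ * (min ‖x‖ 1) ^ (1 + θ)) ^ (1 - θ) with hSdef
  by_cases hwhole : Integrable
      (fun x => (f (x + φ x) - f (x + φ 0) - fderiv ℝ f x (φ x - φ 0)) * g x)
  swap
  · rw [integral_undef hwhole, abs_zero]
    positivity
  obtain ⟨ψ, hψdef⟩ : ∃ ψ : EE d → EE d, ψ = fun x => φ x - φ 0 := ⟨_, rfl⟩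
  have hψx : ∀ x, φ x - φ 0 = ψ x := fun x => by rw [hψdef]
  simp only [hψx] at hψl hψ hb hE1 hE2 hwhole ⊢
  obtain ⟨F, hFdef⟩ : ∃ F : EE d → ℝ, F = fun y => f (y + φ 0) := ⟨_, rfl⟩
  have hF1 : ∀ x, f (x + φ x) = F (x + ψ x) := fun x => by
    rw [hFdef, hψdef]
    simp only
    congr 1
    abel
  have hF0 : ∀ x, f (x + φ 0) = F x := fun x => by rw [hFdef]
  have hFM : ∀ x, |F x| ≤ M := fun x => by rw [hFdef]; exact hM _
  have hFf : ∀ x, |F (x + ψ x) - f x| ≤ H * κ ^ θ := fun x => by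
    rw [← hF1]
    refine (hH _ _).trans ?_
    rw [add_sub_cancel_left]
    gcongr
    exact hφ x
  have hfc := hf.continuous
  have hFc : Continuous F := by rw [hFdef]; fun_prop
  simp only [hF1, hF0] at hwhole ⊢
  have hgc := hg.continuous
  have hgc' : Continuous (fderiv ℝ g) := hg.continuous_fderiv (by norm_num)
  have hPc : Continuous (fun x => x + ψ x) := by fun_prop
  have hanti : AntilipschitzWith 2 (fun x => x + ψ x) := by
    simpa using antilip h0 h1 hψl (t := 1) (by simp)
  have hgP : Integrable (fun x => g (x + ψ x)) := integrable_comp hanti hPc hgi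
  have hFPc : Continuous (fun x => F (x + ψ x)) := hFc.comp hPc
  have i1 : Integrable (fun x => F (x + ψ x) * g x) :=
    hgi.bdd_mul hFPc.aestronglyMeasurable (.of_forall fun x => hFM _)
  have i2 : Integrable (fun x => F x * g x) :=
    hgi.bdd_mul hFc.aestronglyMeasurable (.of_forall fun x => hFM _)
  have i3 : Integrable (fun x => fderiv ℝ f x (ψ x) * g x) := by
    refine ((i1.sub i2).sub hwhole).congr (.of_forall fun x => ?_)
    simp only [Pi.sub_apply]
    ring
  have hgψ : Integrable (fun x => fderiv ℝ g x (ψ x)) := by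
    refine (hgi'.norm.mul_const (2 * κ)).mono' (by fun_prop) (.of_forall fun x => ?_)
    exact (ContinuousLinearMap.le_opNorm _ _).trans (by gcongr; exact hb x)
  have hDm := (divg_meas hψ).aestronglyMeasurable (μ := (volume : Measure (EE d)))
  have hDb := divg_bound h0 hψl
  have i4 : Integrable (fun x => f x * fderiv ℝ g x (ψ x)) :=
    hgψ.bdd_mul hfc.aestronglyMeasurable (.of_forall hM)
  have i5 : Integrable (fun x => divg ψ x * (f x * g x)) :=
    (hgi.bdd_mul hfc.aestronglyMeasurable (.of_forall hM)).bdd_mul hDm (.of_forall hDb)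
  have i6 : Integrable (fun x => F (x + ψ x) * g (x + ψ x)) :=
    hgP.bdd_mul hFPc.aestronglyMeasurable (.of_forall fun x => hFM _)
  have i7 : Integrable (fun x => F (x + ψ x) * g (x + ψ x) * divg ψ x) :=
    (i6.bdd_mul hDm (.of_forall hDb)).congr (.of_forall fun x => mul_comm _ _)
  have hibp := ibp h0 hψl hψ hb hf (hg.of_le (by norm_num)) hM hgi hgi' i3
  have hB := hcv ψ κ h0 h1 hψl (fun x => F x * g x) (hFc.mul hgc) i2
  have hFG : ∫ x, |F x * g x| ≤ M * G := by
    rw [hGdef, ← integral_const_mul]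
    refine integral_mono i2.abs (hgi.abs.const_mul M) fun x => ?_
    simp only [abs_mul]
    gcongr
    exact hFM x
  obtain ⟨rem, hrem⟩ : ∃ rem : EE d → ℝ, rem = fun x =>
      (F (x + ψ x) - f x) * (g x - g (x + ψ x))
      - f x * (g (x + ψ x) - g x - fderiv ℝ g x (ψ x))
      + divg ψ x * ((f x - F (x + ψ x)) * g x + F (x + ψ x) * (g x - g (x + ψ x))) := ⟨_, rfl⟩
  have hremi : rem = fun x => ((F (x + ψ x) * g x - F (x + ψ x) * g (x + ψ x)) +
      (divg ψ x * (f x * g x) - F (x + ψ x) * g (x + ψ x) * divg ψ x))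
      + f x * fderiv ℝ g x (ψ x) := by
    rw [hrem]; funext x; ring
  have j1 := integral_add ((i1.sub i6).add (i5.sub i7)) i4
  have j2 := integral_add (i1.sub i6) (i5.sub i7)
  have j3 := integral_sub i1 i6
  have j4 := integral_sub i5 i7
  have j5 := integral_sub (i1.sub i2) i3
  have j6 := integral_sub i1 i2
  have hI : ∫ x, (F (x + ψ x) - F x - fderiv ℝ f x (ψ x)) * g x =
      ((∫ x, F (x + ψ x) * g (x + ψ x)) - (∫ x, F x * g x) +
        ∫ x, F (x + ψ x) * g (x + ψ x) * divg ψ x) + ∫ x, rem x := by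
    have e : ∀ x, (F (x + ψ x) - F x - fderiv ℝ f x (ψ x)) * g x =
      F (x + ψ x) * g x - F x * g x - fderiv ℝ f x (ψ x) * g x := fun x => by ring
    simp only [Pi.add_apply, Pi.sub_apply] at j1 j2 j3 j4 j5 j6
    simp only [e, hremi]
    linarith
  have k1 : Integrable (fun x => |g (x + ψ x) - g x|) := (hgP.sub hgi).abs
  have k2 : Integrable (fun x => |g (x + ψ x) - g x - fderiv ℝ g x (ψ x)|) :=
    ((hgP.sub hgi).sub hgψ).abs
  have hremb : |∫ x, rem x| ≤ (H * κ ^ θ + d * κ * M) * (∫ x, |g (x + ψ x) - g x|) +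
      M * (∫ x, |g (x + ψ x) - g x - fderiv ℝ g x (ψ x)|) + d * κ * (H * κ ^ θ) * G := by
    have l1 := k1.const_mul (H * κ ^ θ + d * κ * M)
    have l2 := k2.const_mul M
    have l3 := hgi.abs.const_mul (d * κ * (H * κ ^ θ))
    have l12 : Integrable (fun x => (H * κ ^ θ + d * κ * M) * |g (x + ψ x) - g x| +
      M * |g (x + ψ x) - g x - fderiv ℝ g x (ψ x)|) := l1.add l2
    rw [hGdef, ← integral_const_mul, ← integral_const_mul, ← integral_const_mul,
      ← integral_add l1 l2, ← integral_add l12 l3, ← Real.norm_eq_abs]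
    refine norm_integral_le_of_norm_le (l12.add l3) (.of_forall fun x => ?_)
    rw [hrem, Real.norm_eq_abs]
    simp only
    have hx := hFf x
    have hx' : |f x - F (x + ψ x)| ≤ H * κ ^ θ := by rw [abs_sub_comm]; exact hx
    have q1 : |(F (x + ψ x) - f x) * (g x - g (x + ψ x))| ≤
        H * κ ^ θ * |g (x + ψ x) - g x| := by
      rw [abs_mul, abs_sub_comm (g x)]; gcongr
    have q2 : |f x * (g (x + ψ x) - g x - fderiv ℝ g x (ψ x))| ≤
        M * |g (x + ψ x) - g x - fderiv ℝ g x (ψ x)| := by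
      rw [abs_mul]; gcongr; exact hM x
    have q3 : |(f x - F (x + ψ x)) * g x + F (x + ψ x) * (g x - g (x + ψ x))| ≤
        H * κ ^ θ * |g x| + M * |g (x + ψ x) - g x| := by
      refine (abs_add_le _ _).trans ?_
      rw [abs_mul, abs_mul, abs_sub_comm (g x)]
      gcongr
      exact hFM _
    have q4 : |divg ψ x * ((f x - F (x + ψ x)) * g x + F (x + ψ x) * (g x - g (x + ψ x)))| ≤
        d * κ * (H * κ ^ θ * |g x| + M * |g (x + ψ x) - g x|) := by
      rw [abs_mul]
      exact mul_le_mul (hDb x) q3 (abs_nonneg _) (by positivity)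
    refine (abs_add_le _ _).trans ?_
    have := abs_sub ((F (x + ψ x) - f x) * (g x - g (x + ψ x)))
      (f x * (g (x + ψ x) - g x - fderiv ℝ g x (ψ x)))
    linarith
  have hk : κ * κ ^ θ = κ ^ (1 + θ) := by
    rw [Real.rpow_add_of_nonneg h0 (by norm_num) hθ0, Real.rpow_one]
  have hκθ : κ ≤ κ ^ θ := by
    rcases h0.eq_or_lt with h | h
    · rw [← h]; exact Real.rpow_nonneg le_rfl _
    · calc κ = κ ^ (1:ℝ) := (Real.rpow_one _).symm
        _ ≤ _ := Real.rpow_le_rpow_of_exponent_ge h (by linarith) hθ1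
  have hk2 : κ ^ 2 ≤ κ ^ (1 + θ) := by
    rw [← hk, sq]; gcongr
  set k := κ ^ (1 + θ) with hkdef
  have hk0 : 0 ≤ k := Real.rpow_nonneg h0 _
  set A1 := ∫ x, |g (x + ψ x) - g x|
  set A2 := ∫ x, |g (x + ψ x) - g x - fderiv ℝ g x (ψ x)|
  rw [hI]
  refine (abs_add_le _ _).trans ?_
  have b1 : C1 * κ ^ 2 * ∫ x, |F x * g x| ≤ C1 * k * (M * G) := by gcongr
  have b2 : (H * κ ^ θ + d * κ * M) * A1 ≤ (H * κ ^ θ + d * κ * M) * (4 * 2 ^ d * κ * N) := by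
    gcongr
  have b2' : (H * κ ^ θ + d * κ * M) * (4 * 2 ^ d * κ * N) =
      (H * k + d * κ ^ 2 * M) * (4 * 2 ^ d * N) := by rw [← hk]; ring
  have b2'' : (H * k + d * κ ^ 2 * M) * (4 * 2 ^ d * N) ≤
      (H * k + d * k * M) * (4 * 2 ^ d * N) := by gcongr
  have b3 : M * A2 ≤ M * (16 * (1 + 2 ^ d) * k * S) := by gcongr
  have b4 : d * κ * (H * κ ^ θ) * G = d * k * H * G := by rw [← hk]; ring
  have tot : C1 * k * (M * G) + ((H * k + d * k * M) * (4 * 2 ^ d * N) +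
      M * (16 * (1 + 2 ^ d) * k * S) + d * k * H * G) ≤
      (1 + C1 + d + 4 * 2 ^ d + 4 * d * 2 ^ d + 16 * (1 + 2 ^ d)) * k * (M + H) * (G + N + S) := by
    exact tot_aux hC1 (by positivity) (by positivity) hk0 hM0 hH0 hG0 hN0 hS0
  linarith
end
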